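/- arXiv:2305.06427 — 4 statements merged into one kernel-verified Lean document; each statement's English description precedes it below -/
import Mathlib

section
/- For every r with 7/4 ≤ r ≤ 2 and every k ∈ [1/(2r), 2 − 3/r], the convex pentagon K_{r,k} = conv{u₁, u₂, u₃, ((r−3)/r + k)·u₁ + 2k·u₂, ((r−3)/r + k)·u₁ + 2k·u₃} satisfies as(K_{r,k}) = r and d_BM(K_{r,k}, L) = r for every symmetric convex body L ⊆ ℝ². -/
open Set Pointwise

noncomputable section

/-- The unit cube in `ℝⁿ`. -/
def cube (n : ℕ) : Set (Fin n → ℝ) := {x | ∀ i, |x i| ≤ 1}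

/-- The cross-polytope (unit ball of the `ℓ¹` norm) in `ℝⁿ`. -/
def crossPoly (n : ℕ) : Set (Fin n → ℝ) := {x | ∑ i, |x i| ≤ 1}

/-- A convex body: compact, convex, nonempty interior. -/
def IsConvexBody {n : ℕ} (K : Set (Fin n → ℝ)) : Prop :=
  Convex ℝ K ∧ IsCompact K ∧ (interior K).Nonempty

/-- A centrally symmetric set: symmetric about some point `c`. -/
def IsSymmetricBody {n : ℕ} (L : Set (Fin n → ℝ)) : Prop :=
  ∃ c : Fin n → ℝ, L = (fun x => (2 : ℝ) • c - x) '' L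

/-- The Banach–Mazur distance. -/
def bmDist {n : ℕ} (K L : Set (Fin n → ℝ)) : ℝ :=
  sInf {r : ℝ | 0 < r ∧ ∃ (T : (Fin n → ℝ) ≃ₗ[ℝ] (Fin n → ℝ)) (u v : Fin n → ℝ),
    (fun x => x + u) '' K ⊆ ⇑T '' ((fun x => x + v) '' L) ∧
    ⇑T '' ((fun x => x + v) '' L) ⊆ r • ((fun x => x + u) '' K)}

/-- The asymmetry constant of a convex body. -/
def asymConst {n : ℕ} (K : Set (Fin n → ℝ)) : ℝ :=
  sInf {r : ℝ | 0 < r ∧ ∃ z ∈ interior K,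
    (fun x => x - z) '' K ⊆ (-r) • ((fun x => x - z) '' K)}

/-- Vertex `u₁ = (1, 0)` of an equilateral triangle. -/
def u1 : Fin 2 → ℝ := ![1, 0]

/-- Vertex `u₂ = (−1/2, √3/2)` of an equilateral triangle. -/
def u2 : Fin 2 → ℝ := ![-(1/2), Real.sqrt 3 / 2]

/-- Vertex `u₃ = (−1/2, −√3/2)` of an equilateral triangle. -/
def u3 : Fin 2 → ℝ := ![-(1/2), -(Real.sqrt 3 / 2)]

/-- The linear part of the barycentric coordinate at `u1`. -/
def bary1 : (Fin 2 → ℝ) →ₗ[ℝ] ℝ := (2 / 3 : ℝ) • LinearMap.proj 0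

/-- The linear part of the barycentric coordinate at `u2`. -/
def bary2 : (Fin 2 → ℝ) →ₗ[ℝ] ℝ :=
  (-(1 / 3) : ℝ) • LinearMap.proj 0 + (Real.sqrt 3 / 3) • LinearMap.proj 1

/-- The linear part of the barycentric coordinate at `u3`. -/
def bary3 : (Fin 2 → ℝ) →ₗ[ℝ] ℝ :=
  (-(1 / 3) : ℝ) • LinearMap.proj 0 + (-(Real.sqrt 3 / 3)) • LinearMap.proj 1

lemma bary_sum (x : Fin 2 → ℝ) : bary1 x + bary2 x + bary3 x = 0 := by
  simp [bary1, bary2, bary3]; ring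

lemma bary_ext {x y : Fin 2 → ℝ} (h1 : bary1 x = bary1 y) (h2 : bary2 x = bary2 y) : x = y := by
  have h3 : 0 < Real.sqrt 3 := by positivity
  simp only [bary1, bary2, LinearMap.smul_apply, LinearMap.add_apply, LinearMap.proj_apply,
    smul_eq_mul] at h1 h2
  have e0 : x 0 = y 0 := by linarith
  have e1 : Real.sqrt 3 * x 1 = Real.sqrt 3 * y 1 := by rw [e0] at h2; linarith
  have e1 := mul_left_cancel₀ h3.ne' e1
  ext i; fin_cases i <;> assumption

@[simp] lemma bary1_u1 : bary1 u1 = 2 / 3 := by simp [bary1, u1]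
@[simp] lemma bary1_u2 : bary1 u2 = -(1 / 3) := by simp [bary1, u2]; norm_num
@[simp] lemma bary1_u3 : bary1 u3 = -(1 / 3) := by simp [bary1, u3]; norm_num
@[simp] lemma bary2_u1 : bary2 u1 = -(1 / 3) := by simp [bary2, u1]
@[simp] lemma bary2_u2 : bary2 u2 = 2 / 3 := by
  have := Real.mul_self_sqrt (show (0 : ℝ) ≤ 3 by norm_num)
  simp [bary2, u2]; linarith
@[simp] lemma bary2_u3 : bary2 u3 = -(1 / 3) := by
  have := Real.mul_self_sqrt (show (0 : ℝ) ≤ 3 by norm_num)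
  simp [bary2, u3]; linarith
@[simp] lemma bary3_u1 : bary3 u1 = -(1 / 3) := by simp [bary3, u1]
@[simp] lemma bary3_u2 : bary3 u2 = -(1 / 3) := by
  have := Real.mul_self_sqrt (show (0 : ℝ) ≤ 3 by norm_num)
  simp [bary3, u2]; linarith
@[simp] lemma bary3_u3 : bary3 u3 = 2 / 3 := by
  have := Real.mul_self_sqrt (show (0 : ℝ) ≤ 3 by norm_num)
  simp [bary3, u3]; linarith

/-- The pentagon `K_{r,k}`. -/
def pentagon (r k : ℝ) : Set (Fin 2 → ℝ) :=
  convexHull ℝ {u1, u2, u3, ((r - 3) / r + k) • u1 + (2 * k) • u2,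
    ((r - 3) / r + k) • u1 + (2 * k) • u3}

lemma Convex.combo₃_mem {E : Type*} [AddCommGroup E] [Module ℝ E] {s : Set E} (hs : Convex ℝ s)
    {x y z : E} (hx : x ∈ s) (hy : y ∈ s) (hz : z ∈ s) {a b c : ℝ} (ha : 0 ≤ a) (hb : 0 ≤ b)
    (hc : 0 ≤ c) (h : a + b + c = 1) : a • x + b • y + c • z ∈ s := by
  have := hs.sum_mem (t := Finset.univ) (w := ![a, b, c]) (z := ![x, y, z])
    (by intro i _; fin_cases i <;> simpa) (by simpa [Fin.sum_univ_three] using h)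
    (by intro i _; fin_cases i <;> simpa)
  simpa [Fin.sum_univ_three] using this

lemma pentagon_subset_iff {r k : ℝ} {s : Set (Fin 2 → ℝ)} (hs : Convex ℝ s) :
    pentagon r k ⊆ s ↔ u1 ∈ s ∧ u2 ∈ s ∧ u3 ∈ s ∧ ((r - 3) / r + k) • u1 + (2 * k) • u2 ∈ s ∧
      ((r - 3) / r + k) • u1 + (2 * k) • u3 ∈ s := by
  rw [pentagon, hs.convexHull_subset_iff]
  simp [insert_subset_iff]

lemma convex_pentagon (r k : ℝ) : Convex ℝ (pentagon r k) := convex_convexHull _ _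

/-- Half-plane bounds satisfied by the pentagon. -/
lemma bary_bounds_of_mem_pentagon {r k : ℝ} (hr1 : 7 / 4 ≤ r) (hr2 : r ≤ 2)
    (hk1 : 1 / (2 * r) ≤ k) (hk2 : k ≤ 2 - 3 / r) {x : Fin 2 → ℝ} (hx : x ∈ pentagon r k) :
    (2 / 3 - 2 / r ≤ bary1 x ∧ -(1 / 3) ≤ bary2 x ∧ -(1 / 3) ≤ bary3 x) ∧
      bary1 x ≤ 2 / 3 ∧ bary2 x ≤ 2 / 3 ∧ bary3 x ≤ 2 / 3 := by
  have hr0 : 0 < r := by linarith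
  have hq1 : 1 / 2 ≤ 1 / r := one_div_le_one_div_of_le hr0 hr2
  have e3 : 3 / r = 3 * (1 / r) := by ring
  have e2 : 2 / r = 2 * (1 / r) := by ring
  have e4 : (r - 3) / r = 1 - 3 * (1 / r) := by field_simp
  have e5 : 1 / (2 * r) = 1 / r / 2 := by field_simp
  have hq2 : 1 / r ≤ 4 / 7 := by
    have := one_div_le_one_div_of_le (by norm_num) hr1
    norm_num at this ⊢; linarith
  have hconv : Convex ℝ {x | (2 / 3 - 2 / r ≤ bary1 x ∧ -(1 / 3) ≤ bary2 x ∧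
      -(1 / 3) ≤ bary3 x) ∧ bary1 x ≤ 2 / 3 ∧ bary2 x ≤ 2 / 3 ∧ bary3 x ≤ 2 / 3} := by
    refine ((convex_halfSpace_ge bary1.isLinear _).inter
      ((convex_halfSpace_ge bary2.isLinear _).inter (convex_halfSpace_ge bary3.isLinear _))).inter
      ((convex_halfSpace_le bary1.isLinear _).inter
      ((convex_halfSpace_le bary2.isLinear _).inter (convex_halfSpace_le bary3.isLinear _)))
  refine (pentagon_subset_iff hconv).2 ?_ hx
  rw [e3] at hk2
  rw [e5] at hk1
  rw [e2, e4]
  simp only [mem_ofPred_eq, map_add, map_smul, smul_eq_mul, bary1_u1, bary1_u2, bary1_u3, bary2_u1,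
    bary2_u2, bary2_u3, bary3_u1, bary3_u2, bary3_u3]
  generalize 1 / r = q at *
  refine ⟨⟨⟨?_, ?_, ?_⟩, ?_, ?_, ?_⟩, ⟨⟨?_, ?_, ?_⟩, ?_, ?_, ?_⟩, ⟨⟨?_, ?_, ?_⟩, ?_, ?_, ?_⟩,
    ⟨⟨?_, ?_, ?_⟩, ?_, ?_, ?_⟩, ⟨⟨?_, ?_, ?_⟩, ?_, ?_, ?_⟩⟩ <;> linarith

lemma mem_pentagon_of_nonneg {r k : ℝ} {x : Fin 2 → ℝ} (h1 : -(1 / 3) ≤ bary1 x)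
    (h2 : -(1 / 3) ≤ bary2 x) (h3 : -(1 / 3) ≤ bary3 x) : x ∈ pentagon r k := by
  have hv := (pentagon_subset_iff (convex_pentagon r k)).1 Subset.rfl
  have hs := bary_sum x
  have : x = (bary1 x + 1 / 3) • u1 + (bary2 x + 1 / 3) • u2 + (bary3 x + 1 / 3) • u3 := by
    apply bary_ext <;> simp only [map_add, map_smul, smul_eq_mul, bary1_u1, bary1_u2, bary1_u3,
      bary2_u1, bary2_u2, bary2_u3] <;> linarith
  rw [this]
  exact (convex_pentagon r k).combo₃_mem hv.1 hv.2.1 hv.2.2.1 (by linarith) (by linarith)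
    (by linarith) (by linarith)

/-- The point of the edge far from `u1` with given second and third barycentric coordinates. -/
lemma far_edge_mem_pentagon {r k m : ℝ} (hr : 0 < r) (hm : |m| ≤ k) :
    (1 - 2 / r) • u1 + (1 / r + m) • u2 + (1 / r - m) • u3 ∈ pentagon r k := by
  have hv := (pentagon_subset_iff (convex_pentagon r k)).1 Subset.rfl
  obtain ⟨-, -, -, h4, h5⟩ := hv
  have hm' := abs_le.1 hm
  rcases eq_or_lt_of_le ((abs_nonneg m).trans hm) with hk | hk
  · have hm0 : m = 0 := by rw [← hk] at hm'; linarith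
    convert h4 using 1
    subst hm0
    apply bary_ext <;> simp only [map_add, map_smul, smul_eq_mul, bary1_u1, bary1_u2, bary1_u3,
      bary2_u1, bary2_u2, bary2_u3, ← hk] <;> field_simp <;> ring
  · have := convex_pentagon r k h4 h5 (a := (k + m) / (2 * k)) (b := (k - m) / (2 * k))
      (div_nonneg (by linarith) (by linarith)) (div_nonneg (by linarith) (by linarith))
      (by field_simp; ring)
    convert this using 1
    apply bary_ext <;> simp only [map_add, map_smul, smul_eq_mul, bary1_u1, bary1_u2, bary1_u3,
      bary2_u1, bary2_u2, bary2_u3] <;> field_simp <;> ring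

lemma mem_pentagon_of_le {r k : ℝ} (hr1 : 7 / 4 ≤ r) (hk : 1 / (2 * r) ≤ k)
    {x : Fin 2 → ℝ} (h1 : 2 / 3 - 2 / r ≤ bary1 x) (h2 : -(1 / 3) ≤ bary2 x)
    (h3 : -(1 / 3) ≤ bary3 x) (h2' : bary2 x ≤ 3 / (2 * r) - 1 / 3)
    (h3' : bary3 x ≤ 3 / (2 * r) - 1 / 3) : x ∈ pentagon r k := by
  rcases le_or_gt (-(1 / 3)) (bary1 x) with h | h
  · exact mem_pentagon_of_nonneg h h2 h3
  have hr0 : 0 < r := by linarith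
  obtain ⟨-, hu2, hu3, -, -⟩ := (pentagon_subset_iff (convex_pentagon r k)).1 Subset.rfl
  have hs := bary_sum x
  have hq2 : 1 / r ≤ 4 / 7 := by
    have := one_div_le_one_div_of_le (by norm_num) hr1
    norm_num at this ⊢; linarith
  have hq0 : 0 < 1 / r := by positivity
  have hm : |1 / r / 2| ≤ k := by
    rw [abs_of_pos (by positivity)]
    convert hk using 1; field_simp
  have h4 := far_edge_mem_pentagon hr0 hm
  have h5 := far_edge_mem_pentagon (k := k) hr0 (m := -(1 / r / 2)) (by rwa [abs_neg])
  have e2 : 2 / r = 2 * (1 / r) := by ring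
  have e3 : 3 / (2 * r) = 3 / 2 * (1 / r) := by field_simp
  rw [e3] at h2' h3'
  rw [e2] at h1 h4 h5
  generalize 1 / r = q at *
  have hd : 0 < 2 * q - 1 := by linarith
  set t := -(bary1 x + 1 / 3) / (2 * q - 1) with ht
  have ht0 : 0 ≤ t := div_nonneg (by linarith) hd.le
  have ht1 : t ≤ 1 := by rw [ht, div_le_one hd]; linarith
  have htm : t * (2 * q - 1) = -(bary1 x + 1 / 3) := by rw [ht]; field_simp
  have hP := convex_pentagon r k hu2 h4 (sub_nonneg.2 ht1) ht0 (by ring)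
  have hQ := convex_pentagon r k hu3 h5 (sub_nonneg.2 ht1) ht0 (by ring)
  have hw : 0 < 1 - t + t * q := by nlinarith
  have hU : 3 / 2 * q ≤ 1 - t + t * (3 / 2 * q) := by nlinarith
  have := convex_pentagon r k hP hQ
    (a := (bary2 x + 1 / 3 - t * (q / 2)) / (1 - t + t * q))
    (b := (bary3 x + 1 / 3 - t * (q / 2)) / (1 - t + t * q))
    (div_nonneg (by linarith) hw.le) (div_nonneg (by linarith) hw.le)
    (by rw [← add_div, div_eq_one_iff_eq hw.ne']; linarith)
  convert this using 1
  have hb : (bary2 x + 1 / 3 - t * (q / 2)) / (1 - t + t * q) +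
    (bary3 x + 1 / 3 - t * (q / 2)) / (1 - t + t * q) = 1 := by
      rw [← add_div, div_eq_one_iff_eq hw.ne']; linarith
  have ha : (bary2 x + 1 / 3 - t * (q / 2)) / (1 - t + t * q) * (1 - t + t * q) =
    (bary2 x + 1 / 3 - t * (q / 2)) := div_mul_cancel₀ _ hw.ne'
  generalize (bary2 x + 1 / 3 - t * (q / 2)) / (1 - t + t * q) = a at *
  generalize (bary3 x + 1 / 3 - t * (q / 2)) / (1 - t + t * q) = b at *
  obtain rfl : b = 1 - a := by linarith
  apply bary_ext <;> simp only [map_add, map_smul, smul_eq_mul, bary1_u1, bary1_u2, bary1_u3,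
      bary2_u1, bary2_u2, bary2_u3] <;> linarith

/-- The point of minimal asymmetry of the pentagon. -/
def pentagonCenter (r : ℝ) : Fin 2 → ℝ := ((r - 2) / (r + 1)) • u1

/-- Any region with these bounds lies in the image of the pentagon under the homothety of
ratio `-r` about `pentagonCenter r`. -/
lemma reflect_mem_pentagon {r k : ℝ} (hr1 : 7 / 4 ≤ r) (hk : 1 / (2 * r) ≤ k)
    {y : Fin 2 → ℝ} (h1 : bary1 y ≤ 2 / 3) (h2 : bary2 y ≤ 2 / 3) (h3 : bary3 y ≤ 2 / 3)
    (h2' : -(5 / 6) ≤ bary2 y) (h3' : -(5 / 6) ≤ bary3 y) :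
    r⁻¹ • ((1 + r) • pentagonCenter r - y) ∈ pentagon r k := by
  have hr0 : 0 < r := by linarith
  have hc : (1 + r) • pentagonCenter r = (r - 2) • u1 := by
    rw [pentagonCenter, smul_smul]; congr 1; field_simp; ring
  rw [hc]
  apply mem_pentagon_of_le hr1 hk <;>
    simp only [map_sub, map_smul, smul_eq_mul, bary1_u1, bary2_u1, bary3_u1] <;>
    field_simp <;> linarith

lemma le_of_bary_chain {r s : ℝ} (hr : 0 < r) (h : 2 ≤ s * (2 / r)) : r ≤ s := by
  have : s * (2 / r) = 2 * s / r := by ring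
  rw [this, le_div_iff₀ hr] at h
  linarith

lemma u_mem_pentagon (r k : ℝ) :
    u1 ∈ pentagon r k ∧ u2 ∈ pentagon r k ∧ u3 ∈ pentagon r k := by
  have := (pentagon_subset_iff (convex_pentagon r k)).1 Subset.rfl
  exact ⟨this.1, this.2.1, this.2.2.1⟩

lemma asymConst_pentagon {r k : ℝ} (hr1 : 7 / 4 ≤ r) (hr2 : r ≤ 2)
    (hk1 : 1 / (2 * r) ≤ k) (hk2 : k ≤ 2 - 3 / r) : asymConst (pentagon r k) = r := by
  have hr0 : 0 < r := by linarith
  refine IsLeast.csInf_eq ⟨⟨hr0, pentagonCenter r, ?_, ?_⟩, ?_⟩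
  · have hsub : {x | -(1 / 3) < bary1 x ∧ -(1 / 3) < bary2 x ∧ -(1 / 3) < bary3 x} ⊆
        pentagon r k := fun x hx => mem_pentagon_of_nonneg hx.1.le hx.2.1.le hx.2.2.le
    refine interior_maximal hsub ?_ ?_
    · exact (isOpen_lt continuous_const bary1.continuous_of_finiteDimensional).inter
        ((isOpen_lt continuous_const bary2.continuous_of_finiteDimensional).inter
        (isOpen_lt continuous_const bary3.continuous_of_finiteDimensional))
    · have e : (r - 2) / (r + 1) = 1 - 3 / (r + 1) := by field_simp; ring
      have h1 : 3 / (r + 1) < 3 / 2 := by rw [div_lt_div_iff₀] <;> linarith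
      have h2 : 0 < 3 / (r + 1) := by positivity
      simp only [mem_ofPred_eq, pentagonCenter, map_smul, smul_eq_mul, bary1_u1, bary2_u1,
        bary3_u1, e]
      refine ⟨?_, ?_, ?_⟩ <;> linarith
  · rintro _ ⟨x, hx, rfl⟩
    obtain ⟨⟨-, h2', h3'⟩, h1, h2, h3⟩ := bary_bounds_of_mem_pentagon hr1 hr2 hk1 hk2 hx
    have := reflect_mem_pentagon hr1 hk1 h1 h2 h3 (by linarith) (by linarith)
    refine ⟨_, ⟨_, this, rfl⟩, ?_⟩
    ext i
    simp
    field_simp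
    ring
  · rintro s ⟨hs, z, -, h⟩
    have key : ∀ x ∈ pentagon r k, ∃ w ∈ pentagon r k, x - z = (-s) • (w - z) := by
      intro x hx
      obtain ⟨_, ⟨w, hw, rfl⟩, e⟩ := h ⟨x, hx, rfl⟩
      exact ⟨w, hw, e.symm⟩
    obtain ⟨hu1, hu2, hu3⟩ := u_mem_pentagon r k
    obtain ⟨w1, hw1, e1⟩ := key _ hu1
    obtain ⟨w2, hw2, e2⟩ := key _ hu2
    obtain ⟨w3, hw3, e3⟩ := key _ hu3
    have b1 := (bary_bounds_of_mem_pentagon hr1 hr2 hk1 hk2 hw1).1.1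
    have b2 := (bary_bounds_of_mem_pentagon hr1 hr2 hk1 hk2 hw2).1.2.1
    have b3 := (bary_bounds_of_mem_pentagon hr1 hr2 hk1 hk2 hw3).1.2.2
    have e1 := congrArg bary1 e1
    have e2 := congrArg bary2 e2
    have e3 := congrArg bary3 e3
    simp only [map_sub, map_smul, smul_eq_mul, bary1_u1, bary2_u2, bary3_u3] at e1 e2 e3
    have hz := bary_sum z
    have hz' : s * bary1 z + s * bary2 z + s * bary3 z = 0 := by
      rw [← mul_add, ← mul_add, hz, mul_zero]
    have c1 := mul_le_mul_of_nonneg_left b1 hs.le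
    have c2 := mul_le_mul_of_nonneg_left b2 hs.le
    have c3 := mul_le_mul_of_nonneg_left b3 hs.le
    exact le_of_bary_chain hr0 (by linarith)

lemma le_of_pentagon_sandwich {r k s : ℝ} (hr1 : 7 / 4 ≤ r) (hr2 : r ≤ 2)
    (hk1 : 1 / (2 * r) ≤ k) (hk2 : k ≤ 2 - 3 / r) (hs : 0 < s) {M : Set (Fin 2 → ℝ)}
    {c u : Fin 2 → ℝ} (hM : ∀ x ∈ M, (2 : ℝ) • c - x ∈ M)
    (h1 : (fun x => x + u) '' pentagon r k ⊆ M)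
    (h2 : M ⊆ s • ((fun x => x + u) '' pentagon r k)) : r ≤ s := by
  have hr0 : 0 < r := by linarith
  have key : ∀ x ∈ pentagon r k, ∃ w ∈ pentagon r k, (2 : ℝ) • c - (x + u) = s • (w + u) := by
    intro x hx
    obtain ⟨_, ⟨w, hw, rfl⟩, e⟩ := h2 (hM _ (h1 ⟨x, hx, rfl⟩))
    exact ⟨w, hw, e.symm⟩
  obtain ⟨hu1, hu2, hu3⟩ := u_mem_pentagon r k
  obtain ⟨w1, hw1, e1⟩ := key _ hu1
  obtain ⟨w2, hw2, e2⟩ := key _ hu2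
  obtain ⟨w3, hw3, e3⟩ := key _ hu3
  have b1 := (bary_bounds_of_mem_pentagon hr1 hr2 hk1 hk2 hw1).1.1
  have b2 := (bary_bounds_of_mem_pentagon hr1 hr2 hk1 hk2 hw2).1.2.1
  have b3 := (bary_bounds_of_mem_pentagon hr1 hr2 hk1 hk2 hw3).1.2.2
  have e1 := congrArg bary1 e1
  have e2 := congrArg bary2 e2
  have e3 := congrArg bary3 e3
  simp only [map_sub, map_add, map_smul, smul_eq_mul, bary1_u1, bary2_u2, bary3_u3] at e1 e2 e3
  have hu := bary_sum u
  have hc := bary_sum c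
  have hu' : s * bary1 u + s * bary2 u + s * bary3 u = 0 := by
    rw [← mul_add, ← mul_add, hu, mul_zero]
  have c1 := mul_le_mul_of_nonneg_left b1 hs.le
  have c2 := mul_le_mul_of_nonneg_left b2 hs.le
  have c3 := mul_le_mul_of_nonneg_left b3 hs.le
  exact le_of_bary_chain hr0 (by linarith)

/-- Twice the signed area of a planar triangle. -/
def triArea (x y z : Fin 2 → ℝ) : ℝ :=
  (y 0 - x 0) * (z 1 - x 1) - (y 1 - x 1) * (z 0 - x 0)

lemma triArea_rotate (x y z : Fin 2 → ℝ) : triArea y z x = triArea x y z := by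
  simp only [triArea]; ring

lemma exists_maximal_triangle {L : Set (Fin 2 → ℝ)} (hL : IsConvexBody L) :
    ∃ a₁ ∈ L, ∃ a₂ ∈ L, ∃ a₃ ∈ L, 0 < triArea a₁ a₂ a₃ ∧
      ∀ x ∈ L, ∀ y ∈ L, ∀ z ∈ L, triArea x y z ≤ triArea a₁ a₂ a₃ := by
  obtain ⟨-, hc, p, hp⟩ := hL
  have hpL := interior_subset hp
  obtain ⟨⟨a₁, a₂, a₃⟩, ⟨h1, h2, h3⟩, hmax⟩ := (hc.prod (hc.prod hc)).exists_isMaxOn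
    (f := fun q => triArea q.1 q.2.1 q.2.2) ⟨(p, p, p), hpL, hpL, hpL⟩
    (by unfold triArea; fun_prop)
  have hmax' : ∀ x ∈ L, ∀ y ∈ L, ∀ z ∈ L, triArea x y z ≤ triArea a₁ a₂ a₃ :=
    fun x hx y hy z hz => hmax (show (x, y, z) ∈ L ×ˢ L ×ˢ L from ⟨hx, hy, hz⟩)
  refine ⟨a₁, h1, a₂, h2, a₃, h3, ?_, hmax'⟩
  obtain ⟨ε, hε, hb⟩ := Metric.mem_nhds_iff.1 (mem_interior_iff_mem_nhds.1 hp)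
  have hy : p + ![ε / 2, 0] ∈ L := hb (by
    rw [Metric.mem_ball, dist_self_add_left, pi_norm_lt_iff hε]
    intro i; fin_cases i <;> simp [abs_of_pos, hε])
  have hz : p + ![0, ε / 2] ∈ L := hb (by
    rw [Metric.mem_ball, dist_self_add_left, pi_norm_lt_iff hε]
    intro i; fin_cases i <;> simp [abs_of_pos, hε])
  refine lt_of_lt_of_le ?_ (hmax' p hpL _ hy _ hz)
  simp [triArea, hε]

/-- The vertices of a maximal triangle can be labelled so that a given point has its smallest
barycentric coordinate at the first one. -/
lemma exists_maximal_triangle_labelled {L : Set (Fin 2 → ℝ)} (hL : IsConvexBody L)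
    (c : Fin 2 → ℝ) :
    ∃ a₁ ∈ L, ∃ a₂ ∈ L, ∃ a₃ ∈ L, 0 < triArea a₁ a₂ a₃ ∧
      (∀ x ∈ L, ∀ y ∈ L, ∀ z ∈ L, triArea x y z ≤ triArea a₁ a₂ a₃) ∧
      triArea c a₂ a₃ ≤ triArea a₁ c a₃ ∧ triArea c a₂ a₃ ≤ triArea a₁ a₂ c := by
  obtain ⟨a₁, h1, a₂, h2, a₃, h3, hpos, hmax⟩ := exists_maximal_triangle hL
  have r1 := triArea_rotate a₁ a₂ a₃
  have r2 := triArea_rotate a₂ a₃ a₁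
  have s1 := triArea_rotate c a₂ a₃
  have s1' := triArea_rotate a₂ a₃ c
  have s2 := triArea_rotate c a₃ a₁
  have s2' := triArea_rotate a₃ a₁ c
  have s3 := triArea_rotate c a₁ a₂
  have s3' := triArea_rotate a₁ a₂ c
  by_cases h12 : triArea c a₂ a₃ ≤ triArea a₁ c a₃
  · by_cases h13 : triArea c a₂ a₃ ≤ triArea a₁ a₂ c
    · exact ⟨a₁, h1, a₂, h2, a₃, h3, hpos, hmax, h12, h13⟩
    · refine ⟨a₃, h3, a₁, h1, a₂, h2, ?_, ?_, ?_, ?_⟩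
      · linarith
      · intro x hx y hy z hz
        linarith [hmax x hx y hy z hz]
      · linarith
      · linarith
  · by_cases h23 : triArea a₁ c a₃ ≤ triArea a₁ a₂ c
    · refine ⟨a₂, h2, a₃, h3, a₁, h1, ?_, ?_, ?_, ?_⟩
      · linarith
      · intro x hx y hy z hz
        linarith [hmax x hx y hy z hz]
      · linarith
      · linarith
    · refine ⟨a₃, h3, a₁, h1, a₂, h2, ?_, ?_, ?_, ?_⟩
      · linarith
      · intro x hx y hy z hz
        linarith [hmax x hx y hy z hz]
      · linarith
      · linarith

/-- The pentagon lies in every symmetric convex set through `u1`, `u2`, `u3` whose centre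
has suitable barycentric coordinates. -/
lemma pentagon_subset_of_symmetric {r k : ℝ} (hr1 : 7 / 4 ≤ r) (hr2 : r ≤ 2)
    (hk1 : 1 / (2 * r) ≤ k) (hk2 : k ≤ 2 - 3 / r) {M : Set (Fin 2 → ℝ)} (hM : Convex ℝ M)
    {c : Fin 2 → ℝ} (hc : ∀ x ∈ M, (2 : ℝ) • c - x ∈ M) (h1 : u1 ∈ M) (h2 : u2 ∈ M)
    (h3 : u3 ∈ M) (h12 : bary1 c ≤ bary2 c) (h13 : bary1 c ≤ bary3 c) :
    pentagon r k ⊆ M := by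
  have hr0 : 0 < r := by linarith
  have hs := bary_sum c
  have hq1 : 1 / 2 ≤ 1 / r := one_div_le_one_div_of_le hr0 hr2
  have e3 : 3 / r = 3 * (1 / r) := by ring
  have e4 : (r - 3) / r = 1 - 3 * (1 / r) := by field_simp
  have e5 : 1 / (2 * r) = 1 / r / 2 := by field_simp
  have hq2 : 1 / r ≤ 4 / 7 := by
    have := one_div_le_one_div_of_le (by norm_num) hr1
    norm_num at this ⊢; linarith
  rw [pentagon_subset_iff hM]
  rw [e3] at hk2
  rw [e5] at hk1
  rw [e4]
  generalize 1 / r = q at *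
  have hd : 0 < 1 / 3 - 2 * bary1 c := by linarith
  set t := (2 * q - 1) / (1 / 3 - 2 * bary1 c) with ht
  have ht0 : 0 ≤ t := div_nonneg (by linarith) hd.le
  have ht1 : t * (1 / 3 - 2 * bary1 c) = 2 * q - 1 := div_mul_cancel₀ _ hd.ne'
  have ht2 : t * (bary1 c) ≤ t * (bary2 c) := mul_le_mul_of_nonneg_left h12 ht0
  have ht3 : t * (bary1 c) ≤ t * (bary3 c) := mul_le_mul_of_nonneg_left h13 ht0
  have hts : t * bary1 c + t * bary2 c + t * bary3 c = 0 := by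
    rw [← mul_add, ← mul_add, hs, mul_zero]
  refine ⟨h1, h2, h3, ?_, ?_⟩
  · have := hM.combo₃_mem (hc _ h1) h2 h3 (a := t)
      (b := q + k - t * (2 * bary2 c + 2 / 3)) (c := q - k - t * (2 * bary3 c + 2 / 3))
      ht0 (by linarith) (by linarith) (by linarith)
    convert this using 1
    apply bary_ext <;> simp only [map_add, map_sub, map_smul, smul_eq_mul, bary1_u1, bary1_u2,
      bary1_u3, bary2_u1, bary2_u2, bary2_u3] <;> linarith
  · have := hM.combo₃_mem (hc _ h1) h2 h3 (a := t)
      (b := q - k - t * (2 * bary2 c + 2 / 3)) (c := q + k - t * (2 * bary3 c + 2 / 3))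
      ht0 (by linarith) (by linarith) (by linarith)
    convert this using 1
    apply bary_ext <;> simp only [map_add, map_sub, map_smul, smul_eq_mul, bary1_u1, bary1_u2,
      bary1_u3, bary2_u1, bary2_u2, bary2_u3] <;> linarith

/-- The linear part of the affine map sending `u1, u2, u3` to `a₁, a₂, a₃`. -/
def triMap (a₁ a₂ a₃ : Fin 2 → ℝ) : (Fin 2 → ℝ) →ₗ[ℝ] (Fin 2 → ℝ) :=
  bary1.smulRight a₁ + bary2.smulRight a₂ + bary3.smulRight a₃

lemma triArea_triMap (a₁ a₂ a₃ y : Fin 2 → ℝ) :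
    triArea (triMap a₁ a₂ a₃ y + (1 / 3 : ℝ) • (a₁ + a₂ + a₃)) a₂ a₃ =
        (bary1 y + 1 / 3) * triArea a₁ a₂ a₃ ∧
      triArea a₁ (triMap a₁ a₂ a₃ y + (1 / 3 : ℝ) • (a₁ + a₂ + a₃)) a₃ =
        (bary2 y + 1 / 3) * triArea a₁ a₂ a₃ ∧
      triArea a₁ a₂ (triMap a₁ a₂ a₃ y + (1 / 3 : ℝ) • (a₁ + a₂ + a₃)) =
        (bary3 y + 1 / 3) * triArea a₁ a₂ a₃ := by
  have h : bary3 y = -bary1 y - bary2 y := by linarith [bary_sum y]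
  simp only [triArea, triMap, LinearMap.add_apply, LinearMap.smulRight_apply, Pi.add_apply,
    Pi.smul_apply, smul_eq_mul, h]
  refine ⟨?_, ?_, ?_⟩ <;> ring

lemma triMap_injective {a₁ a₂ a₃ : Fin 2 → ℝ} (h : 0 < triArea a₁ a₂ a₃) :
    Function.Injective (triMap a₁ a₂ a₃) := by
  intro x y hxy
  have hx := triArea_triMap a₁ a₂ a₃ x
  have hy := triArea_triMap a₁ a₂ a₃ y
  rw [hxy] at hx
  have e1 := mul_right_cancel₀ h.ne' (hx.1.symm.trans hy.1)
  have e2 := mul_right_cancel₀ h.ne' (hx.2.1.symm.trans hy.2.1)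
  exact bary_ext (by linarith) (by linarith)

lemma exists_pentagon_sandwich {r k : ℝ} (hr1 : 7 / 4 ≤ r) (hr2 : r ≤ 2)
    (hk1 : 1 / (2 * r) ≤ k) (hk2 : k ≤ 2 - 3 / r) {L : Set (Fin 2 → ℝ)} (hL : IsConvexBody L)
    {c₀ : Fin 2 → ℝ} (hc₀ : ∀ x ∈ L, (2 : ℝ) • c₀ - x ∈ L) :
    ∃ (T : (Fin 2 → ℝ) ≃ₗ[ℝ] (Fin 2 → ℝ)) (u v : Fin 2 → ℝ),
      (fun x => x + u) '' pentagon r k ⊆ ⇑T '' ((fun x => x + v) '' L) ∧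
      ⇑T '' ((fun x => x + v) '' L) ⊆ r • ((fun x => x + u) '' pentagon r k) := by
  have hr0 : 0 < r := by linarith
  obtain ⟨a₁, ha₁, a₂, ha₂, a₃, ha₃, hpos, hmax, h12, h13⟩ :=
    exists_maximal_triangle_labelled hL c₀
  let S := LinearEquiv.ofInjectiveEndo (triMap a₁ a₂ a₃) (triMap_injective hpos)
  have hS : ∀ y, S y = triMap a₁ a₂ a₃ y := fun y => rfl
  set g : Fin 2 → ℝ := (1 / 3 : ℝ) • (a₁ + a₂ + a₃) with hg
  set c := S.symm (c₀ - g) with hc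
  have hSc : S c + g = c₀ := by simp [hc]
  set M : Set (Fin 2 → ℝ) := {y | S y + g ∈ L} with hM
  have hMc : ∀ y ∈ M, (2 : ℝ) • c - y ∈ M := by
    intro y hy
    have := hc₀ _ hy
    rw [hM, mem_ofPred_eq]
    convert this using 1
    rw [← hSc, map_sub, map_smul]
    module
  have hMconv : Convex ℝ M := by
    intro x hx y hy a b ha hb hab
    have := hL.1 hx hy ha hb hab
    rw [hM, mem_ofPred_eq]
    convert this using 1
    rw [map_add, map_smul, map_smul]
    obtain rfl : b = 1 - a := by linarith
    module
  have hMle : ∀ y ∈ M, bary1 y ≤ 2 / 3 ∧ bary2 y ≤ 2 / 3 ∧ bary3 y ≤ 2 / 3 := by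
    intro y hy
    have e := triArea_triMap a₁ a₂ a₃ y
    rw [← hS, ← hg] at e
    have m1 := hmax _ hy _ ha₂ _ ha₃
    have m2 := hmax _ ha₁ _ hy _ ha₃
    have m3 := hmax _ ha₁ _ ha₂ _ hy
    rw [e.1] at m1
    rw [e.2.1] at m2
    rw [e.2.2] at m3
    refine ⟨?_, ?_, ?_⟩ <;> nlinarith
  have hu : u1 ∈ M ∧ u2 ∈ M ∧ u3 ∈ M := by
    refine ⟨?_, ?_, ?_⟩
    · rw [hM, mem_ofPred_eq]
      convert ha₁ using 1
      simp only [hS, hg, triMap, LinearMap.add_apply, LinearMap.smulRight_apply, bary1_u1,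
        bary2_u1, bary3_u1]
      module
    · rw [hM, mem_ofPred_eq]
      convert ha₂ using 1
      simp only [hS, hg, triMap, LinearMap.add_apply, LinearMap.smulRight_apply, bary1_u2,
        bary2_u2, bary3_u2]
      module
    · rw [hM, mem_ofPred_eq]
      convert ha₃ using 1
      simp only [hS, hg, triMap, LinearMap.add_apply, LinearMap.smulRight_apply, bary1_u3,
        bary2_u3, bary3_u3]
      module
  have ec := triArea_triMap a₁ a₂ a₃ c
  rw [← hS, ← hg, hSc] at ec
  rw [ec.1, ec.2.1] at h12
  rw [ec.1, ec.2.2] at h13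
  replace h12 := le_of_mul_le_mul_right h12 hpos
  replace h13 := le_of_mul_le_mul_right h13 hpos
  have hKM : pentagon r k ⊆ M := pentagon_subset_of_symmetric hr1 hr2 hk1 hk2 hMconv hMc hu.1
    hu.2.1 hu.2.2 (by linarith) (by linarith)
  have hcs := bary_sum c
  have b2 : bary2 c ≤ 1 / 6 := by
    have := (hMle _ (hMc _ hu.1)).2.1
    simp only [map_sub, map_smul, smul_eq_mul, bary2_u1] at this
    linarith
  have b3 : bary3 c ≤ 1 / 6 := by
    have := (hMle _ (hMc _ hu.1)).2.2
    simp only [map_sub, map_smul, smul_eq_mul, bary3_u1] at this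
    linarith
  have hMref : ∀ y ∈ M, r⁻¹ • ((1 + r) • pentagonCenter r - ((2 : ℝ) • c - y)) ∈
      pentagon r k := by
    intro y hy
    obtain ⟨l1, l2, l3⟩ := hMle _ (hMc _ hy)
    obtain ⟨-, m2, m3⟩ := hMle _ hy
    refine reflect_mem_pentagon hr1 hk1 l1 l2 l3 ?_ ?_ <;>
      simp only [map_sub, map_smul, smul_eq_mul] <;> linarith
  set u : Fin 2 → ℝ := (r - 1)⁻¹ • ((2 : ℝ) • c - (1 + r) • pentagonCenter r) with hu'
  refine ⟨S.symm, u, S u - g, ?_, ?_⟩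
  · rintro _ ⟨x, hx, rfl⟩
    refine ⟨_, ⟨_, hKM hx, rfl⟩, ?_⟩
    rw [LinearEquiv.symm_apply_eq, map_add]
    module
  · rintro _ ⟨_, ⟨l, hl, rfl⟩, rfl⟩
    have hy : S.symm (l - g) ∈ M := by simpa [hM] using hl
    refine ⟨_, ⟨_, hMref _ hy, rfl⟩, ?_⟩
    have e : S.symm (l + (S u - g)) = S.symm (l - g) + u := by
      rw [LinearEquiv.symm_apply_eq, map_add, S.apply_symm_apply]; module
    have hru : (r - 1) • u = (2 : ℝ) • c - (1 + r) • pentagonCenter r := by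
      rw [hu', smul_smul, mul_inv_cancel₀ (by linarith), one_smul]
    have hru' : r • u = u + ((2 : ℝ) • c - (1 + r) • pentagonCenter r) := by
      rw [← hru]; module
    simp only [e, smul_add, smul_smul, mul_inv_cancel₀ hr0.ne', one_smul, hru']
    module

/-- the convex pentagon `K_{r,k}` has asymmetry constant `r` and
Banach–Mazur distance `r` to every symmetric convex body. -/
theorem stmt16 (r k : ℝ) (hr1 : 7/4 ≤ r) (hr2 : r ≤ 2)
    (hk : k ∈ Set.Icc (1 / (2 * r)) (2 - 3 / r)) :
    asymConst (convexHull ℝ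
      {u1, u2, u3, ((r - 3) / r + k) • u1 + (2 * k) • u2,
        ((r - 3) / r + k) • u1 + (2 * k) • u3}) = r ∧
    ∀ L : Set (Fin 2 → ℝ), IsConvexBody L → IsSymmetricBody L →
      bmDist (convexHull ℝ
        {u1, u2, u3, ((r - 3) / r + k) • u1 + (2 * k) • u2,
          ((r - 3) / r + k) • u1 + (2 * k) • u3}) L = r := by
  obtain ⟨hk1, hk2⟩ := hk
  refine ⟨asymConst_pentagon hr1 hr2 hk1 hk2, fun L hL hsym => ?_⟩
  obtain ⟨c₀, hc₀⟩ := hsym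
  have hc : ∀ x ∈ L, (2 : ℝ) • c₀ - x ∈ L := fun x hx => by
    rw [hc₀]; exact ⟨x, hx, rfl⟩
  refine IsLeast.csInf_eq ⟨⟨by linarith, exists_pentagon_sandwich hr1 hr2 hk1 hk2 hL hc⟩, ?_⟩
  rintro s ⟨hs, T, u, v, h1, h2⟩
  refine le_of_pentagon_sandwich hr1 hr2 hk1 hk2 hs (c := T (c₀ + v)) ?_ h1 h2
  rintro _ ⟨_, ⟨l, hl, rfl⟩, rfl⟩
  refine ⟨_, ⟨_, hc _ hl, rfl⟩, ?_⟩
  rw [← map_smul, ← map_sub]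
  congr 1
  module
end
end

section
/- Let 7/4 < r < 2 and let k₁, k₂ ∈ (1/(2r), 2 − 3/r) with k₁ ≠ k₂. Then the pentagons K_{r,k₁} and K_{r,k₂} are not affinely equivalent: there is no bijective affine map f : ℝ² → ℝ² with f(K_{r,k₁}) = K_{r,k₂}, where for a parameter k, K_{r,k} = conv{u₁, u₂, u₃, ((r−3)/r + k)·u₁ + 2k·u₂, ((r−3)/r + k)·u₁ + 2k·u₃}. -/
open Set Pointwise

noncomputable section

/-- The point with abscissa `x` and ordinate `√3 * y`. -/
def scaledPoint (x y : ℝ) : Fin 2 → ℝ := ![x, Real.sqrt 3 * y]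

/-- The vertices of the pentagon `K_{r,k}`, with `s = 3 / r`. -/
def pentagonVertices (s k : ℝ) : Set (Fin 2 → ℝ) :=
  {scaledPoint 1 0, scaledPoint (-1 / 2) (1 / 2), scaledPoint (-1 / 2) (-1 / 2),
    scaledPoint (1 - s) k, scaledPoint (1 - s) (-k)}

theorem vertices_eq_pentagonVertices {r : ℝ} (hr : r ≠ 0) (k : ℝ) :
    ({u1, u2, u3, ((r - 3) / r + k) • u1 + (2 * k) • u2,
      ((r - 3) / r + k) • u1 + (2 * k) • u3} : Set (Fin 2 → ℝ)) =
      pentagonVertices (3 / r) k := by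
  have h1 : u1 = scaledPoint 1 0 := by
    ext i; fin_cases i <;> simp [u1, scaledPoint]
  have h2 : u2 = scaledPoint (-1 / 2) (1 / 2) := by
    ext i; fin_cases i <;> (simp [u2, scaledPoint]; ring)
  have h3 : u3 = scaledPoint (-1 / 2) (-1 / 2) := by
    ext i; fin_cases i <;> (simp [u3, scaledPoint]; ring)
  have h4 : ((r - 3) / r + k) • u1 + (2 * k) • u2 = scaledPoint (1 - 3 / r) k := by
    ext i; fin_cases i <;> (simp [u1, u2, scaledPoint]; field_simp) <;> ring
  have h5 : ((r - 3) / r + k) • u1 + (2 * k) • u3 = scaledPoint (1 - 3 / r) (-k) := by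
    ext i; fin_cases i <;> (simp [u1, u3, scaledPoint]; field_simp) <;> ring
  rw [h4, h5, h1, h2, h3, pentagonVertices]

/-- A point of `V` at which a linear functional attains a strict maximum over `V` is an extreme
point of the convex hull of `V`. -/
theorem mem_extremePoints_convexHull_of_forall_lt {E : Type*} [AddCommGroup E] [Module ℝ E]
    {V : Set E} {v : E} (hv : v ∈ V) (l : E →ₗ[ℝ] ℝ) (h : ∀ w ∈ V, w ≠ v → l w < l v) :
    v ∈ (convexHull ℝ V).extremePoints ℝ := by
  have key : ∀ w ∈ convexHull ℝ V, w = v ∨ l w < l v := by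
    have hc : Convex ℝ {w | w = v ∨ l w < l v} := by
      intro x hx y hy a b ha hb hab
      by_cases hx' : x = v
      · by_cases hy' : y = v
        · left
          rw [hx', hy', ← add_smul, hab, one_smul]
        · have hy2 := hy.resolve_left hy'
          rcases hb.eq_or_lt with rfl | hb
          · left
            simp_all
          · right
            simp only [map_add, map_smul, smul_eq_mul, hx']
            obtain rfl : a = 1 - b := by linarith
            nlinarith [mul_pos hb (sub_pos.2 hy2)]
      · have hx2 := hx.resolve_left hx'
        rcases ha.eq_or_lt with rfl | ha
        · simp_all
        · right
          have hy2 : l y ≤ l v := by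
            rcases hy with rfl | hy
            exacts [le_rfl, hy.le]
          simp only [map_add, map_smul, smul_eq_mul]
          obtain rfl : b = 1 - a := by linarith
          nlinarith [mul_pos ha (sub_pos.2 hx2), mul_nonneg hb (sub_nonneg.2 hy2)]
    exact convexHull_min (fun w hw => (em (w = v)).imp_right (h w hw)) hc
  refine ⟨subset_convexHull ℝ V hv, ?_⟩
  rintro x hx y hy ⟨a, b, ha, hb, hab, hxy⟩
  have hl : a * l x + b * l y = l v := by
    rw [← hxy]; simp
  rcases key x hx with hx | hx
  · exact hx
  · have hy' : l y ≤ l v := by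
      rcases key y hy with rfl | hy
      exacts [le_rfl, hy.le]
    obtain rfl : b = 1 - a := by linarith
    nlinarith [mul_pos ha (sub_pos.2 hx), mul_nonneg hb.le (sub_nonneg.2 hy')]

/-- An injective affine map sends extreme points to extreme points of the image. -/
theorem AffineMap.map_mem_extremePoints_image {E F : Type*} [AddCommGroup E] [Module ℝ E]
    [AddCommGroup F] [Module ℝ F] (f : E →ᵃ[ℝ] F) (hf : Function.Injective f) {s : Set E} {x : E}
    (hx : x ∈ s.extremePoints ℝ) : f x ∈ (f '' s).extremePoints ℝ := by
  refine ⟨mem_image_of_mem f hx.1, ?_⟩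
  rintro _ ⟨y, hy, rfl⟩ _ ⟨z, hz, rfl⟩ hyz
  rw [← image_openSegment, hf.mem_set_image] at hyz
  rw [hx.2 hy hz hyz]

/-- The functional `(x, y) ↦ a * x + b * y / √3`. -/
def scaledFunctional (a b : ℝ) : (Fin 2 → ℝ) →ₗ[ℝ] ℝ :=
  a • LinearMap.proj 0 + (b / Real.sqrt 3) • LinearMap.proj 1

theorem scaledFunctional_scaledPoint (a b x y : ℝ) :
    scaledFunctional a b (scaledPoint x y) = a * x + b * y := by
  have : Real.sqrt 3 ≠ 0 := by positivity
  simp [scaledFunctional, scaledPoint]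
  field_simp

theorem pentagonVertices_extreme {s k : ℝ} (hs : 3 / 2 < s) (hs' : s < 2) (hk : 0 < k)
    (hk' : k < 1 / 2) {v : Fin 2 → ℝ}
    (hv : v = scaledPoint (-1 / 2) (1 / 2) ∨ v = scaledPoint (-1 / 2) (-1 / 2) ∨
      v = scaledPoint (1 - s) k ∨ v = scaledPoint (1 - s) (-k)) :
    v ∈ (convexHull ℝ (pentagonVertices s k)).extremePoints ℝ := by
  rcases hv with rfl | rfl | rfl | rfl
  · refine mem_extremePoints_convexHull_of_forall_lt (by simp [pentagonVertices])
      (scaledFunctional 0 1) ?_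
    rintro w (rfl | rfl | rfl | rfl | rfl) hw <;> simp only [scaledFunctional_scaledPoint] <;>
      first | exact absurd rfl hw | nlinarith
  · refine mem_extremePoints_convexHull_of_forall_lt (by simp [pentagonVertices])
      (scaledFunctional 0 (-1)) ?_
    rintro w (rfl | rfl | rfl | rfl | rfl) hw <;> simp only [scaledFunctional_scaledPoint] <;>
      first | exact absurd rfl hw | nlinarith
  · refine mem_extremePoints_convexHull_of_forall_lt (by simp [pentagonVertices])
      (scaledFunctional (-1) (s - 3 / 2)) ?_
    rintro w (rfl | rfl | rfl | rfl | rfl) hw <;> simp only [scaledFunctional_scaledPoint] <;>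
      first | exact absurd rfl hw | nlinarith
  · refine mem_extremePoints_convexHull_of_forall_lt (by simp [pentagonVertices])
      (scaledFunctional (-1) (3 / 2 - s)) ?_
    rintro w (rfl | rfl | rfl | rfl | rfl) hw <;> simp only [scaledFunctional_scaledPoint] <;>
      first | exact absurd rfl hw | nlinarith

theorem scaledPoint_sub_eq_smul {x₁ y₁ x₂ y₂ x₃ y₃ x₄ y₄ t : ℝ}
    (h : scaledPoint x₁ y₁ - scaledPoint x₂ y₂ = t • (scaledPoint x₃ y₃ - scaledPoint x₄ y₄)) :
    x₁ - x₂ = t * (x₃ - x₄) ∧ y₁ - y₂ = t * (y₃ - y₄) := by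
  have h3 : Real.sqrt 3 ≠ 0 := by positivity
  have h0 := congrFun h 0
  have h1 := congrFun h 1
  simp only [scaledPoint, Pi.sub_apply, Pi.smul_apply, smul_eq_mul, Matrix.cons_val_zero,
    Matrix.cons_val_one] at h0 h1
  exact ⟨h0, mul_left_cancel₀ h3 (by linear_combination h1)⟩

theorem scaledPoint_cross_eq_zero {x₁ y₁ x₂ y₂ x₃ y₃ x₄ y₄ t : ℝ}
    (h : scaledPoint x₁ y₁ - scaledPoint x₂ y₂ = t • (scaledPoint x₃ y₃ - scaledPoint x₄ y₄)) :
    (x₁ - x₂) * (y₃ - y₄) - (y₁ - y₂) * (x₃ - x₄) = 0 := by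
  obtain ⟨hx, hy⟩ := scaledPoint_sub_eq_smul h
  rw [hx, hy]
  ring

set_option maxHeartbeats 1000000 in
/-- Among the segments joining two vertices of the pentagon, the only parallel ones with no common
endpoint are the two vertical ones, whose lengths have ratio `2 * k`. -/
theorem eq_two_mul_of_sub_eq_smul {s k t : ℝ} (hs : 3 / 2 < s) (hs' : s < 12 / 7)
    (hk : s / 6 < k) (hk' : k < 2 - s) (ht : 0 < t) (ht' : t < 1) {a b c d : Fin 2 → ℝ}
    (ha : a ∈ pentagonVertices s k) (hb : b ∈ pentagonVertices s k)
    (hc : c ∈ pentagonVertices s k) (hd : d ∈ pentagonVertices s k)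
    (hab : a ≠ b) (hac : a ≠ c) (had : a ≠ d) (hbc : b ≠ c) (hbd : b ≠ d) (hcd : c ≠ d)
    (h : a - b = t • (c - d)) : t = 2 * k := by
  have hp : k * (4 * s - 3) < s := by nlinarith
  have hq : 3 / 2 * k < s * k := by nlinarith
  have hq' : 0 < (s - 3 / 2) * (1 / 2 - k) := by nlinarith
  have htk : 0 < t * k := by nlinarith
  have htk' : t * k < k := by nlinarith
  rcases ha with rfl | rfl | rfl | rfl | rfl <;> rcases hb with rfl | rfl | rfl | rfl | rfl <;>
  first
  | exact absurd rfl hab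
  | (rcases hc with rfl | rfl | rfl | rfl | rfl <;>
     first
     | exact absurd rfl hac
     | exact absurd rfl hbc
     | (rcases hd with rfl | rfl | rfl | rfl | rfl <;>
        first
        | exact absurd rfl had
        | exact absurd rfl hbd
        | exact absurd rfl hcd
        | (obtain ⟨hx, hy⟩ := scaledPoint_sub_eq_smul h
           linarith)
        | (exfalso
           have hcross := scaledPoint_cross_eq_zero h
           ring_nf at hcross hp hq hq'
           linarith)))

/-- for `7/4 < r < 2` and distinct parameters `k₁ ≠ k₂` in the open
interval, the pentagons `K_{r,k₁}` and `K_{r,k₂}` are not affinely equivalent. -/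
theorem stmt17 (r k₁ k₂ : ℝ) (hr1 : 7/4 < r) (hr2 : r < 2)
    (hk₁ : k₁ ∈ Set.Ioo (1 / (2 * r)) (2 - 3 / r))
    (hk₂ : k₂ ∈ Set.Ioo (1 / (2 * r)) (2 - 3 / r)) (hne : k₁ ≠ k₂) :
    ¬ ∃ f : (Fin 2 → ℝ) →ᵃ[ℝ] (Fin 2 → ℝ), Function.Bijective f ∧
      f '' (convexHull ℝ
        {u1, u2, u3, ((r - 3) / r + k₁) • u1 + (2 * k₁) • u2,
          ((r - 3) / r + k₁) • u1 + (2 * k₁) • u3}) =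
      convexHull ℝ
        {u1, u2, u3, ((r - 3) / r + k₂) • u1 + (2 * k₂) • u2,
          ((r - 3) / r + k₂) • u1 + (2 * k₂) • u3} := by
  rintro ⟨f, ⟨hinj, -⟩, hf⟩
  have hr : 0 < r := by linarith
  rw [vertices_eq_pentagonVertices hr.ne', vertices_eq_pentagonVertices hr.ne'] at hf
  have hs : 3 / 2 < 3 / r := by gcongr
  have hs' : 3 / r < 12 / 7 := by rw [div_lt_div_iff₀ hr (by norm_num)]; linarith
  have h6 : 1 / (2 * r) = 3 / r / 6 := by field_simp; norm_num
  rw [h6] at hk₁ hk₂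
  obtain ⟨hk₁, hk₁'⟩ := hk₁
  obtain ⟨hk₂, hk₂'⟩ := hk₂
  generalize 3 / r = s at *
  have hmem : ∀ v, (v = scaledPoint (-1 / 2) (1 / 2) ∨ v = scaledPoint (-1 / 2) (-1 / 2) ∨
      v = scaledPoint (1 - s) k₁ ∨ v = scaledPoint (1 - s) (-k₁)) →
      f v ∈ pentagonVertices s k₂ := fun v hv =>
    extremePoints_convexHull_subset (hf ▸ f.map_mem_extremePoints_image hinj
      (pentagonVertices_extreme hs (by linarith) (by linarith) (by linarith) hv))
  have hne' : ∀ x y x' y', (x ≠ x' ∨ y ≠ y') → f (scaledPoint x y) ≠ f (scaledPoint x' y') := by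
    intro x y x' y' hxy h
    have h' := hinj h
    have h3 : Real.sqrt 3 ≠ 0 := by positivity
    have h0 := congrFun h' 0
    have h1 := congrFun h' 1
    simp [scaledPoint] at h0 h1
    tauto
  have hsub : f (scaledPoint (1 - s) k₁) - f (scaledPoint (1 - s) (-k₁)) =
      (2 * k₁) • (f (scaledPoint (-1 / 2) (1 / 2)) - f (scaledPoint (-1 / 2) (-1 / 2))) := by
    simp only [← vsub_eq_sub, ← f.linearMap_vsub, ← map_smul]
    congr 1
    ext i
    fin_cases i <;> simp [scaledPoint]
    ring
  have := eq_two_mul_of_sub_eq_smul hs hs' hk₂ hk₂' (by linarith) (by linarith)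
    (hmem _ (by simp)) (hmem _ (by simp)) (hmem _ (by simp)) (hmem _ (by simp))
    (hne' _ _ _ _ (Or.inr (by linarith))) (hne' _ _ _ _ (Or.inl (by linarith)))
    (hne' _ _ _ _ (Or.inl (by linarith))) (hne' _ _ _ _ (Or.inl (by linarith)))
    (hne' _ _ _ _ (Or.inl (by linarith))) (hne' _ _ _ _ (Or.inr (by norm_num))) hsub
  exact hne (by linarith)
end
end

section
/- Let K ⊆ ℝ² be a convex body and r ∈ ℝ such that d_BM(K, L) = r for every symmetric convex body L ⊆ ℝ². Then r ≥ √(3/2); moreover K is not smooth (some boundary point of K admits two distinct supporting lines) and not strictly convex (the boundary of K contains a nondegenerate segment). -/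
open Set Pointwise

noncomputable section

theorem eq_smul_single_add_smul_single (x : Fin 2 → ℝ) :
    x = x 0 • Pi.single 0 1 + x 1 • Pi.single 1 1 := by
  ext i; fin_cases i <;> simp

theorem mem_frontier_of_forall_le {E : Type*} [NormedAddCommGroup E] [NormedSpace ℝ E]
    {K : Set E} {x : E} (hx : x ∈ K) {f : E →ₗ[ℝ] ℝ} (hf : f ≠ 0) (h : ∀ y ∈ K, f y ≤ f x) :
    x ∈ frontier K := by
  refine ⟨subset_closure hx, fun hi => hf ?_⟩
  ext v
  have key : ∀ v, f v ≤ 0 := by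
    intro v
    have hc : Filter.Tendsto (fun t : ℝ => x + t • v) (nhdsWithin 0 (Ioi 0)) (nhds x) := by
      have : Continuous (fun t : ℝ => x + t • v) := by fun_prop
      simpa using (this.tendsto 0).mono_left nhdsWithin_le_nhds
    obtain ⟨t, ht, ht0⟩ := ((hc.eventually (mem_interior_iff_mem_nhds.1 hi)).and
      self_mem_nhdsWithin).exists
    have := h _ ht
    simp only [map_add, map_smul, smul_eq_mul] at this
    have ht0 : 0 < t := ht0
    by_contra! hv
    nlinarith [mul_pos ht0 hv]
  have h1 := key v
  have h2 := key (-v)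
  rw [map_neg] at h2
  simpa using le_antisymm h1 (by linarith)

theorem Convex.image_smul_add {E : Type*} [AddCommGroup E] [Module ℝ E] {K : Set E}
    (hK : Convex ℝ K) (r : ℝ) (w : E) : Convex ℝ ((fun k => r • k + w) '' K) := by
  have : (fun k => r • k + w) '' K = (fun x => w + x) '' (r • K) := by
    rw [← image_smul, image_image]
    simp [add_comm]
  exact this ▸ (hK.smul r).translate w

theorem notMem_interior_of_forall_add_smul {E : Type*} [NormedAddCommGroup E] [NormedSpace ℝ E]
    {Q : Set E} {x d : E} (h : ∀ ε : ℝ, 0 < ε → x + ε • d ∉ interior Q) : x ∉ interior Q := by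
  intro hi
  have hc : Continuous (fun t : ℝ => x + t • d) := by fun_prop
  have hev : ∀ᶠ t in nhds (0 : ℝ), x + t • d ∈ interior Q :=
    (isOpen_interior.preimage hc).mem_nhds (by simpa using hi)
  obtain ⟨t, ht, ht0⟩ := ((hev.filter_mono nhdsWithin_le_nhds).and
    (self_mem_nhdsWithin (s := Ioi (0 : ℝ)))).exists
  exact h t ht0 ht

theorem exists_segment_subset_frontier {E : Type*} [NormedAddCommGroup E] [NormedSpace ℝ E]
    {K : Set E} (hK : Convex ℝ K) {a b : E} (hab : a ≠ b) (ha : a ∈ K) (hb : b ∈ K)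
    {f : E →ₗ[ℝ] ℝ} (hf : f ≠ 0) (hfab : f a = f b) (h : ∀ y ∈ K, f y ≤ f a) :
    ∃ a b : E, a ≠ b ∧ a ∈ frontier K ∧ b ∈ frontier K ∧ segment ℝ a b ⊆ frontier K := by
  have key : segment ℝ a b ⊆ frontier K := by
    intro x hx
    have hxK := hK.segment_subset ha hb hx
    refine mem_frontier_of_forall_le hxK hf ?_
    obtain ⟨s, t, hs, ht, hst, rfl⟩ := hx
    have : f (s • a + t • b) = f a := by
      rw [map_add, map_smul, map_smul, ← hfab, ← add_smul, hst, one_smul]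
    rwa [this]
  exact ⟨a, b, hab, key (left_mem_segment ℝ a b), key (right_mem_segment ℝ a b), key⟩

/-- If every point of a compact set `M` enters the interior of a convex set `Q` when pushed in the
direction `d`, then all points of `M` do so simultaneously. -/
theorem exists_forall_add_smul_mem_interior {E : Type*} [NormedAddCommGroup E] [NormedSpace ℝ E]
    {M Q : Set E} (hM : IsCompact M) (hQ : Convex ℝ Q) (hMQ : M ⊆ Q) (d : E)
    (h : ∀ x ∈ M, ∃ ε : ℝ, 0 < ε ∧ x + ε • d ∈ interior Q) :
    ∃ ε : ℝ, 0 < ε ∧ ∀ x ∈ M, x + ε • d ∈ interior Q := by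
  have key : ∀ᶠ ε in nhdsWithin (0 : ℝ) (Ioi 0), ∀ x ∈ M, x + ε • d ∈ interior Q := by
    refine hM.induction_on (p := fun S => ∀ᶠ ε in nhdsWithin (0 : ℝ) (Ioi 0),
      ∀ x ∈ S, x + ε • d ∈ interior Q) (by simp)
      (fun s t hst ht => ht.mono fun ε hε x hx => hε x (hst hx))
      (fun s t hs ht => (hs.and ht).mono fun ε hε x hx => hx.elim (hε.1 x) (hε.2 x)) ?_
    intro x hx
    obtain ⟨ε, hε, hxε⟩ := h x hx
    have hc : Continuous (fun y : E => y + ε • d) := by fun_prop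
    refine ⟨M ∩ {y | y + ε • d ∈ interior Q}, Filter.inter_mem self_mem_nhdsWithin
      (mem_nhdsWithin_of_mem_nhds ((isOpen_interior.preimage hc).mem_nhds hxε)), ?_⟩
    filter_upwards [Ioc_mem_nhdsGT hε] with δ hδ y hy
    have := hQ.add_smul_mem_interior (hMQ hy.1) hy.2 (t := δ / ε)
      ⟨div_pos hδ.1 hε, (div_le_one hε).2 hδ.2⟩
    rwa [smul_smul, div_mul_cancel₀ _ hε.ne'] at this
  obtain ⟨ε, h1, h2⟩ := (key.and self_mem_nhdsWithin).exists
  exact ⟨ε, h2, h1⟩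

/-- If `-K` is contained in no homothet of `K` smaller than `r • K`, then for no direction `d` can
`-K` be moved into the interior of `r • K + w` by pushing it in the direction `d`. -/
theorem exists_forall_notMem_interior {E : Type*} [NormedAddCommGroup E] [NormedSpace ℝ E]
    {K : Set E} (hK : Convex ℝ K) (hKc : IsCompact K) {r : ℝ} (hr : 0 < r) {w : E}
    (hsub : ∀ x ∈ K, -x ∈ (fun k => r • k + w) '' K)
    (hmin : ∀ ρ : ℝ, 0 < ρ → ∀ w' : E, (∀ x ∈ K, -x ∈ (fun k => ρ • k + w') '' K) → r ≤ ρ)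
    (d : E) :
    ∃ x ∈ K, ∀ ε : ℝ, 0 < ε → -x + ε • d ∉ interior ((fun k => r • k + w) '' K) := by
  set Q := (fun k => r • k + w) '' K with hQ
  by_contra! hcon
  have hQc : Convex ℝ Q := hK.image_smul_add r w
  obtain ⟨ε, hε, h⟩ := exists_forall_add_smul_mem_interior (M := -K) hKc.neg hQc
    (fun x hx => by simpa using hsub (-x) hx) d (fun x hx => by simpa using hcon (-x) hx)
  have hev : ∀ᶠ t in nhds (1 : ℝ), ∀ x ∈ -K, t • (x + ε • d) ∈ interior Q := by
    refine hKc.neg.eventually_forall_of_forall_eventually fun x hx => ?_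
    have hc : Continuous (fun z : ℝ × E => z.1 • (z.2 + ε • d)) := by fun_prop
    refine (isOpen_interior.preimage hc).mem_nhds ?_
    rw [mem_preimage, one_smul]
    exact h x hx
  obtain ⟨t, ht, ht1⟩ := ((hev.filter_mono nhdsWithin_le_nhds).and
    (self_mem_nhdsWithin (s := Ioi (1 : ℝ)))).exists
  have ht1 : 1 < t := ht1
  have ht0 : 0 < t := by linarith
  have := hmin (r / t) (by positivity) (t⁻¹ • w - ε • d) fun x hx => by
    obtain ⟨k, hk, hkx⟩ := interior_subset (ht (-x) (by simpa using hx))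
    refine ⟨k, hk, ?_⟩
    have h2 : -x + ε • d = t⁻¹ • (r • k + w) := by
      have hkx : r • k + w = t • (-x + ε • d) := hkx
      rw [hkx, smul_smul, inv_mul_cancel₀ ht0.ne', one_smul]
    have h3 : -x = t⁻¹ • (r • k + w) - ε • d := by rw [← h2]; abel
    simp only [h3, smul_add, smul_smul, div_eq_inv_mul]
    abel
  have h4 : r / t < r := div_lt_self hr ht1
  linarith

theorem mem_interior_cube {x : Fin 2 → ℝ} (h : ∀ i, |x i| < 1) : x ∈ interior (cube 2) := by
  have ho : IsOpen {y : Fin 2 → ℝ | ∀ i, |y i| < 1} := by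
    simp only [ofPred_forall]
    exact isOpen_iInter_of_finite fun i => isOpen_lt (by fun_prop) continuous_const
  exact interior_maximal (fun y hy i => (hy i).le) ho h

/-- A convex set containing the square is supported, at a boundary point lying on the square but
not at one of its vertices, by a side of the square. -/
theorem exists_side_support {Q : Set (Fin 2 → ℝ)} (hQ : Convex ℝ Q) (hcQ : cube 2 ⊆ Q)
    {x : Fin 2 → ℝ} (hx : x ∈ cube 2) (hxQ : x ∉ interior Q) (hv : ¬ ∀ i, |x i| = 1) :
    ∃ i, |x i| = 1 ∧ (∀ j, j ≠ i → |x j| < 1) ∧ ∀ y ∈ Q, x i * y i ≤ 1 := by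
  have hne : (interior Q).Nonempty :=
    ⟨0, interior_mono hcQ (mem_interior_cube (by simp))⟩
  obtain ⟨f, hf⟩ := geometric_hahn_banach_open_point hQ.interior isOpen_interior hxQ
  have hle : ∀ y ∈ Q, f y ≤ f x := by
    intro y hy
    have hcl : y ∈ closure (interior Q) := by
      rw [hQ.closure_interior_eq_closure_of_nonempty_interior hne]
      exact subset_closure hy
    exact closure_minimal (fun z hz => (hf z hz).le)
      (isClosed_le f.continuous continuous_const) hcl
  have hpos : 0 < f x := by
    have := hf 0 (interior_mono hcQ (mem_interior_cube (by simp)))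
    simpa using this
  have hfe : ∀ y, f y = f (Pi.single 0 1) * y 0 + f (Pi.single 1 1) * y 1 := by
    intro y
    conv_lhs => rw [eq_smul_single_add_smul_single y]
    simp only [map_add, map_smul, smul_eq_mul]
    ring
  generalize f (Pi.single 0 1) = a at hfe
  generalize f (Pi.single 1 1) = b at hfe
  have hx0 := hx 0
  have hx1 := hx 1
  have hcorner : ∀ s t : ℝ, |s| ≤ 1 → |t| ≤ 1 → a * s + b * t ≤ a * x 0 + b * x 1 := by
    intro s t hs ht
    have := hle ![s, t] (hcQ (by intro i; fin_cases i <;> simpa))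
    simpa [hfe] using this
  rw [hfe] at hpos
  have side : ∀ a b s t : ℝ, 0 < a * s + b * t → |s| ≤ 1 → |t| < 1 →
      (∀ s' t', |s'| ≤ 1 → |t'| ≤ 1 → a * s' + b * t' ≤ a * s + b * t) →
      b = 0 ∧ |s| = 1 := by
    intro a b s t hp hs ht hm
    have hb : b = 0 := by
      have h1 := hm s 1 hs (by simp)
      have h2 := hm s (-1) hs (by simp)
      obtain ⟨h3, h4⟩ := abs_lt.1 ht
      have : b ≤ 0 := by by_contra! hb; nlinarith
      have : 0 ≤ b := by by_contra! hb; nlinarith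
      linarith
    subst hb
    refine ⟨rfl, le_antisymm hs ?_⟩
    have h1 := hm 1 t (by simp) ht.le
    have h2 := hm (-1) t (by simp) ht.le
    by_contra! hs
    obtain ⟨h3, h4⟩ := abs_lt.1 hs
    rcases le_total a 0 with ha | ha <;> nlinarith
  have fin : ∀ a s y : ℝ, 0 < a * s → |s| = 1 → a * y ≤ a * s → s * y ≤ 1 := by
    intro a s y hp hs hy
    rcases eq_or_eq_neg_of_abs_eq hs with rfl | rfl <;> nlinarith
  by_cases h1 : |x 1| = 1
  · have h0 : |x 0| < 1 := lt_of_le_of_ne hx0 fun h0 => hv (by intro i; fin_cases i <;> assumption)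
    obtain ⟨ha, -⟩ := side b a (x 1) (x 0) (by linarith) hx1 h0 fun s t hs ht => by
      linarith [hcorner t s ht hs]
    subst ha
    refine ⟨1, h1, fun j hj => ?_, fun y hy => fin b _ _ (by linarith) h1 ?_⟩
    · fin_cases j
      · exact h0
      · exact absurd rfl hj
    · have := hle y hy
      simpa [hfe] using this
  · obtain ⟨ha, h0⟩ := side a b (x 0) (x 1) hpos hx0 (lt_of_le_of_ne hx1 h1) hcorner
    subst ha
    refine ⟨0, h0, fun j hj => ?_, fun y hy => fin a _ _ (by linarith) h0 ?_⟩
    · fin_cases j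
      · exact absurd rfl hj
      · exact lt_of_le_of_ne hx1 h1
    · have := hle y hy
      simpa [hfe] using this

theorem proj_ne_zero (i : Fin 2) {c : ℝ} (hc : c ≠ 0) :
    c • (LinearMap.proj i : (Fin 2 → ℝ) →ₗ[ℝ] ℝ) ≠ 0 := by
  intro h
  have := LinearMap.congr_fun h 1
  simp at this
  exact hc this

theorem not_smooth_of_subset_cube {K : Set (Fin 2 → ℝ)} (hK : Convex ℝ K) (hKc : IsCompact K)
    {r : ℝ} (hr : 1 < r) {w : Fin 2 → ℝ} (hcube : K ⊆ cube 2)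
    (hsub : cube 2 ⊆ (fun k => r • k + w) '' K)
    (hmin : ∀ ρ : ℝ, 0 < ρ → ∀ w' : Fin 2 → ℝ,
      (∀ x ∈ K, -x ∈ (fun k => ρ • k + w') '' K) → r ≤ ρ) :
    ∃ x ∈ frontier K, ∃ f g : (Fin 2 → ℝ) →ₗ[ℝ] ℝ,
      f ≠ 0 ∧ g ≠ 0 ∧ (¬ ∃ c : ℝ, g = c • f) ∧
      (∀ y ∈ K, f y ≤ f x) ∧ (∀ y ∈ K, g y ≤ g x) := by
  by_cases hv : ∃ x ∈ K, ∀ i, |x i| = 1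
  · obtain ⟨x, hx, hx1⟩ := hv
    have hne : ∀ i, x i ≠ 0 := fun i h0 => by simpa [h0] using hx1 i
    have hle : ∀ i, ∀ y ∈ K, (x i • (LinearMap.proj i : (Fin 2 → ℝ) →ₗ[ℝ] ℝ)) y
        ≤ (x i • (LinearMap.proj i : (Fin 2 → ℝ) →ₗ[ℝ] ℝ)) x := by
      intro i y hy
      have h1 := hcube hy i
      simp only [LinearMap.smul_apply, LinearMap.proj_apply, smul_eq_mul]
      calc x i * y i ≤ |x i * y i| := le_abs_self _
        _ = |x i| * |y i| := abs_mul _ _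
        _ ≤ |x i| * |x i| := by rw [hx1 i]; linarith
        _ = x i * x i := abs_mul_abs_self _
    refine ⟨x, mem_frontier_of_forall_le hx (proj_ne_zero 0 (hne 0)) (hle 0), _, _,
      proj_ne_zero 0 (hne 0), proj_ne_zero 1 (hne 1), ?_, hle 0, hle 1⟩
    rintro ⟨c, hc⟩
    have := LinearMap.congr_fun hc (Pi.single 1 1)
    simp at this
    exact hne 1 this
  · push Not at hv
    exfalso
    set Q := (fun k => r • k + w) '' K with hQ
    have hQc : Convex ℝ Q := hK.image_smul_add r w
    have hneg : ∀ x ∈ K, -x ∈ cube 2 := fun x hx i => by simpa using hcube hx i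
    have key : ∀ d : Fin 2 → ℝ, (∀ i, |d i| = 1) →
        ∃ i, (∃ x ∈ K, x i = -d i) ∧ ∀ y ∈ Q, d i * y i ≤ 1 := by
      intro d hd
      obtain ⟨x, hx, hxd⟩ := exists_forall_notMem_interior hK hKc (by linarith)
        (fun x hx => hsub (hneg x hx)) hmin d
      have hxQ := notMem_interior_of_forall_add_smul hxd
      obtain ⟨i, hi, hj, hy⟩ := exists_side_support hQc hsub (hneg x hx) hxQ
        (by simpa only [Pi.neg_apply, abs_neg, not_forall] using hv x hx)
      have hid : d i = (-x) i := by
        by_contra hne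
        have hopp : (-x) i = -d i := by
          rcases abs_eq_abs.1 (hi.trans (hd i).symm) with h | h
          · exact absurd h.symm hne
          · exact h
        obtain ⟨ε, hε, hε1, hεj⟩ : ∃ ε : ℝ, 0 < ε ∧ ε < 1 ∧ ∀ j, j ≠ i → |(-x) j| + ε < 1 := by
          have hji : 1 - i ≠ i := by fin_cases i <;> decide
          have hlt := hj (1 - i) hji
          refine ⟨(1 - |(-x) (1 - i)|) / 2, by linarith, by linarith [abs_nonneg ((-x) (1 - i))],
            fun j hji => ?_⟩
          have : j = 1 - i := by omega
          subst this
          linarith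
        refine hxd ε hε (interior_mono hsub (mem_interior_cube fun j => ?_))
        by_cases hji : j = i
        · subst hji
          have : (-x + ε • d) j = -((1 - ε) * d j) := by
            rw [Pi.add_apply, hopp, Pi.smul_apply, smul_eq_mul]; ring
          rw [this, abs_neg, abs_mul, hd, abs_of_pos (by linarith)]
          linarith
        · calc |(-x + ε • d) j| ≤ |(-x) j| + |ε * d j| := abs_add_le _ _
            _ = |(-x) j| + ε := by rw [abs_mul, hd, abs_of_pos hε, mul_one]
            _ < 1 := hεj j hji
      refine ⟨i, ⟨x, hx, by simp [hid]⟩, fun y hyQ => ?_⟩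
      rw [hid]
      exact hy y hyQ
    have key2 : ∃ i, ∀ σ : ℝ, |σ| = 1 → (∃ x ∈ K, x i = -σ) ∧ ∀ y ∈ Q, σ * y i ≤ 1 := by
      by_contra! hcon
      obtain ⟨σ, hσ, h0⟩ := hcon 0
      obtain ⟨τ, hτ, h1⟩ := hcon 1
      obtain ⟨i, hi1, hi2⟩ := key ![σ, τ] (by intro i; fin_cases i <;> simpa)
      fin_cases i
      · obtain ⟨y, hy, hy1⟩ := h0 hi1
        have := hi2 y hy
        simp at this
        linarith
      · obtain ⟨y, hy, hy1⟩ := h1 hi1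
        have := hi2 y hy
        simp at this
        linarith
    obtain ⟨i, hi⟩ := key2
    obtain ⟨⟨x, hx, hxi⟩, h1⟩ := hi 1 (by simp)
    obtain ⟨⟨x', hx', hxi'⟩, h2⟩ := hi (-1) (by simp)
    have h3 := h1 _ (mem_image_of_mem _ hx')
    have h4 := h2 _ (mem_image_of_mem _ hx)
    simp only [Pi.add_apply, Pi.smul_apply, smul_eq_mul, hxi, hxi'] at h3 h4
    linarith

theorem not_strictConvex_of_subset_cube {K : Set (Fin 2 → ℝ)} (hK : Convex ℝ K)
    (hKc : IsCompact K) {r : ℝ} (hr : 1 < r) {w : Fin 2 → ℝ} (hcube : K ⊆ cube 2)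
    (hsub : cube 2 ⊆ (fun k => r • k + w) '' K)
    (hmin : ∀ ρ : ℝ, 0 < ρ → ∀ w' : Fin 2 → ℝ,
      (∀ x ∈ K, -x ∈ (fun k => ρ • k + w') '' K) → r ≤ ρ) :
    ∃ a b : Fin 2 → ℝ, a ≠ b ∧ a ∈ frontier K ∧ b ∈ frontier K ∧
      segment ℝ a b ⊆ frontier K := by
  set Q := (fun k => r • k + w) '' K with hQ
  have hQc : Convex ℝ Q := hK.image_smul_add r w
  have hneg : ∀ x ∈ K, -x ∈ cube 2 := fun x hx i => by simpa using hcube hx i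
  by_contra hcon
  have hint : ∀ y ∈ Q, ∀ θ : ℝ, 0 ≤ θ → θ < 1 → θ • y ∈ interior Q := by
    intro y hy θ h0 h1
    have hz : (0 : Fin 2 → ℝ) ∈ interior Q := interior_mono hsub (mem_interior_cube (by simp))
    have := hQc.combo_interior_self_mem_interior hz hy (a := 1 - θ) (b := θ) (by linarith) h0
      (by ring)
    simpa using this
  have key : ∀ d : Fin 2 → ℝ, ∃ x ∈ K, (∀ i, |x i| = 1) ∧
      ∀ ε : ℝ, 0 < ε → -x + ε • d ∉ interior Q := by
    intro d
    obtain ⟨x, hx, hxd⟩ := exists_forall_notMem_interior hK hKc (by linarith)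
      (fun x hx => hsub (hneg x hx)) hmin d
    refine ⟨x, hx, ?_, hxd⟩
    have hxQ := notMem_interior_of_forall_add_smul hxd
    by_contra hv
    obtain ⟨i, hi, -, hy⟩ := exists_side_support hQc hsub (hneg x hx) hxQ (by simpa using hv)
    have hmem : ∀ s : ℝ, |s| ≤ 1 → Function.update (-x) (1 - i) s ∈ cube 2 := by
      intro s hs j
      by_cases hj : j = 1 - i
      · subst hj; simpa using hs
      · rw [Function.update_of_ne hj]; exact hneg x hx j
    have hii : i ≠ 1 - i := by fin_cases i <;> decide
    obtain ⟨a, ha, hae⟩ := hsub (hmem 1 (by simp))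
    obtain ⟨b, hb, hbe⟩ := hsub (hmem (-1) (by simp))
    have hai : r * a i + w i = (-x) i := by
      have := congrFun hae i
      rwa [Function.update_of_ne hii] at this
    have hbi : r * b i + w i = (-x) i := by
      have := congrFun hbe i
      rwa [Function.update_of_ne hii] at this
    have hxx : (-x) i * (-x) i = 1 := by rw [← abs_mul_abs_self, hi, one_mul]
    refine hcon (exists_segment_subset_frontier hK (a := a) (b := b) ?_ ha hb
      (f := (-x) i • LinearMap.proj i) (proj_ne_zero i fun h0 => by simp [h0] at hxx) ?_ ?_)
    · rintro rfl
      have := congrFun (hae.symm.trans hbe) (1 - i)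
      simp at this
      linarith
    · have : a i = b i := mul_left_cancel₀ (by linarith : r ≠ 0) (by linarith)
      simp [this]
    · intro y hyK
      have h1 := hy _ (mem_image_of_mem _ hyK)
      simp only [Pi.add_apply, Pi.smul_apply, smul_eq_mul] at h1
      simp only [LinearMap.smul_apply, LinearMap.proj_apply, smul_eq_mul]
      rw [← hxx, ← hai] at h1
      rw [← hai]
      have : r * ((r * a i + w i) * y i) ≤ r * ((r * a i + w i) * a i) := by nlinarith
      exact le_of_mul_le_mul_left this (by linarith)
  have huniq : ∀ x ∈ K, ∀ y ∈ K, (∀ i, |x i| = 1) → (∀ i, |y i| = 1) → ∀ i, x i = y i →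
      x = y := by
    intro x hx y hy hx1 hy1 i hi
    by_contra hne
    have hxx : x i * x i = 1 := by rw [← abs_mul_abs_self, hx1, one_mul]
    refine hcon (exists_segment_subset_frontier hK hne hx hy (f := x i • LinearMap.proj i)
      (proj_ne_zero i fun h0 => by simp [h0] at hxx) (by simp [hi]) fun z hz => ?_)
    simp only [LinearMap.smul_apply, LinearMap.proj_apply, smul_eq_mul]
    calc x i * z i ≤ |x i * z i| := le_abs_self _
      _ = |z i| := by rw [abs_mul, hx1, one_mul]
      _ ≤ 1 := hcube hz i
      _ = x i * x i := hxx.symm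
  obtain ⟨v, hv, hv1, hvd⟩ := key w
  have hnv : -v ∉ K := by
    intro h
    have h1 := hint _ (mem_image_of_mem _ h) r⁻¹ (by positivity) (inv_lt_one_of_one_lt₀ hr)
    refine hvd r⁻¹ (by positivity) ?_
    rwa [smul_add, smul_smul, inv_mul_cancel₀ (by linarith), one_smul] at h1
  obtain ⟨x, hx, hx1, hxd⟩ := key v
  have hxv : x = v := by
    have hor : ∀ i, x i = v i ∨ x i = -v i := fun i =>
      abs_eq_abs.1 ((hx1 i).trans (hv1 i).symm)
    by_cases h : ∃ i, x i = v i
    · obtain ⟨i, hi⟩ := h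
      exact huniq x hx v hv hx1 hv1 i hi
    · push Not at h
      refine absurd ?_ hnv
      have : x = -v := by ext i; exact (hor i).resolve_left (h i)
      rwa [← this]
  subst hxv
  refine hxd (1 / 2) (by norm_num) ?_
  have h1 := hint _ (hsub (hneg x hx)) (1 / 2) (by norm_num) (by norm_num)
  have h2 : -x + (1 / 2 : ℝ) • x = (1 / 2 : ℝ) • -x := by module
  rwa [h2]

theorem isClosed_setOf_exists_mem {X Y Z : Type*} [TopologicalSpace X] [TopologicalSpace Y]
    [TopologicalSpace Z] [T2Space Z] {K : Set Y} (hK : IsCompact K) {f g : X × Y → Z}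
    (hf : Continuous f) (hg : Continuous g) : IsClosed {x | ∃ y ∈ K, f (x, y) = g (x, y)} := by
  have : CompactSpace K := isCompact_iff_compactSpace.1 hK
  have hc : Continuous fun z : X × K => (z.1, (z.2 : Y)) := by fun_prop
  have h := isClosedMap_fst_of_compactSpace (X := X) (Y := K) _
    (isClosed_eq (hf.comp hc) (hg.comp hc))
  convert h using 1
  ext x
  simp

/-- The set whose infimum is the Banach–Mazur distance. -/
def bmSet {n : ℕ} (K L : Set (Fin n → ℝ)) : Set ℝ :=
  {r : ℝ | 0 < r ∧ ∃ (T : (Fin n → ℝ) ≃ₗ[ℝ] (Fin n → ℝ)) (u v : Fin n → ℝ),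
    (fun x => x + u) '' K ⊆ ⇑T '' ((fun x => x + v) '' L) ∧
    ⇑T '' ((fun x => x + v) '' L) ⊆ r • ((fun x => x + u) '' K)}

theorem bddBelow_bmSet {n : ℕ} (K L : Set (Fin n → ℝ)) : BddBelow (bmSet K L) :=
  ⟨0, fun _ h => h.1.le⟩

theorem mem_bmSet {n : ℕ} {K L : Set (Fin n → ℝ)} {r : ℝ} :
    r ∈ bmSet K L ↔ 0 < r ∧ ∃ (T : (Fin n → ℝ) ≃ₗ[ℝ] (Fin n → ℝ)) (u v : Fin n → ℝ),
      (∀ x ∈ K, ∃ y ∈ L, T (y + v) = x + u) ∧ ∀ y ∈ L, ∃ x ∈ K, r • (x + u) = T (y + v) := by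
  refine and_congr Iff.rfl (exists_congr fun T => exists_congr fun u => exists_congr fun v =>
    and_congr ?_ ?_) <;>
  simp only [subset_def, mem_image, mem_smul_set] <;> aesop

theorem exists_ball_subset_translate {n : ℕ} {K : Set (Fin n → ℝ)} (hK : IsConvexBody K) :
    ∃ (z : Fin n → ℝ) (δ B : ℝ), 0 < δ ∧ 0 < B ∧ (∀ x, ‖x‖ ≤ δ → x + z ∈ K) ∧
      ∀ x ∈ K, ‖x - z‖ ≤ B := by
  obtain ⟨-, hc, z, hz⟩ := hK
  obtain ⟨δ, hδ, h⟩ := Metric.isOpen_iff.1 isOpen_interior z hz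
  obtain ⟨B, hB⟩ := hc.isBounded.subset_closedBall z
  refine ⟨z, δ / 2, max B 1, by positivity, by positivity, fun x hx => ?_, fun x hx => ?_⟩
  · refine interior_subset (h ?_)
    rw [Metric.mem_ball, dist_eq_norm, add_sub_cancel_right]
    linarith
  · have := hB hx
    rw [Metric.mem_closedBall, dist_eq_norm] at this
    exact this.trans (le_max_left _ _)

theorem bmSet_nonempty {n : ℕ} {K L : Set (Fin n → ℝ)} (hK : IsConvexBody K)
    (hL : IsConvexBody L) : (bmSet K L).Nonempty := by
  obtain ⟨z, δ, B, hδ, hB, h1, h2⟩ := exists_ball_subset_translate hK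
  obtain ⟨z', δ', B', hδ', hB', h1', h2'⟩ := exists_ball_subset_translate hL
  have ht : B / δ' ≠ 0 := by positivity
  refine ⟨B / δ' * B' / δ, mem_bmSet.2 ⟨by positivity,
    LinearEquiv.smulOfNeZero ℝ (Fin n → ℝ) (B / δ') ht, -z, -z', fun x hx => ?_, fun y hy => ?_⟩⟩
  · refine ⟨(B / δ')⁻¹ • (x - z) + z', h1' _ ?_, ?_⟩
    · rw [norm_smul, Real.norm_of_nonneg (by positivity), inv_div, div_mul_eq_mul_div,
        div_le_iff₀ hB]
      exact mul_le_mul_of_nonneg_left (h2 x hx) hδ'.le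
    · simp only [LinearEquiv.smulOfNeZero_apply, add_neg_cancel_right, smul_smul,
        mul_inv_cancel₀ ht, one_smul, sub_eq_add_neg]
  · refine ⟨(δ / B') • (y - z') + z, h1 _ ?_, ?_⟩
    · rw [norm_smul, Real.norm_of_nonneg (by positivity), div_mul_eq_mul_div, div_le_iff₀ hB']
      exact mul_le_mul_of_nonneg_left (h2' y hy) hδ.le
    · simp only [LinearEquiv.smulOfNeZero_apply, add_neg_cancel_right, smul_smul, sub_eq_add_neg]
      congr 1
      field_simp

theorem isConvexBody_sub_self {n : ℕ} {K : Set (Fin n → ℝ)} (hK : IsConvexBody K) :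
    IsConvexBody (K - K) := by
  obtain ⟨h1, h2, h3⟩ := hK
  refine ⟨h1.sub h1, sub_eq_add_neg K K ▸ h2.add h2.neg, (h3.sub (h3.mono interior_subset)).mono ?_⟩
  exact interior_maximal (sub_subset_sub_right interior_subset) isOpen_interior.sub_right

theorem isSymmetricBody_sub_self {n : ℕ} (K : Set (Fin n → ℝ)) : IsSymmetricBody (K - K) := by
  refine ⟨0, ?_⟩
  simp

/-- The distance of `K` to its difference body is at most its asymmetry. -/
theorem bmDist_sub_self_le {n : ℕ} {K : Set (Fin n → ℝ)} {ρ : ℝ} (hρ : 0 < ρ) {w : Fin n → ℝ}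
    (h : ∀ x ∈ K, -x ∈ (fun k => ρ • k + w) '' K) (hK : Convex ℝ K) :
    bmDist K (K - K) ≤ ρ := by
  refine csInf_le (bddBelow_bmSet _ _) (mem_bmSet.2 ⟨hρ,
    LinearEquiv.smulOfNeZero ℝ (Fin n → ℝ) (ρ / (1 + ρ)) (by positivity), (1 + ρ)⁻¹ • w, 0, ?_, ?_⟩)
  · intro x hx
    obtain ⟨k, hk, hkx⟩ := h x hx
    refine ⟨x - k, sub_mem_sub hx hk, ?_⟩
    have hw : w = -x - ρ • k := by rw [← hkx]; simp
    ext i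
    simp [hw]
    field_simp
    ring
  · intro y hy
    obtain ⟨x, hx, x', hx', rfl⟩ := hy
    obtain ⟨k, hk, hkx⟩ := h x' hx'
    have hw : w = -x' - ρ • k := by rw [← hkx]; simp
    refine ⟨(1 + ρ)⁻¹ • x + (ρ / (1 + ρ)) • k, hK hx hk (by positivity) (by positivity)
      (by field_simp), ?_⟩
    ext i
    simp [hw]
    field_simp
    ring

theorem isConvexBody_cube (n : ℕ) : IsConvexBody (cube n) := by
  have : cube n = Metric.closedBall (0 : Fin n → ℝ) 1 := by
    ext x
    simp [cube, pi_norm_le_iff_of_nonneg]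
  rw [this]
  exact ⟨convex_closedBall _ _, isCompact_closedBall _ _,
    ⟨0, Metric.ball_subset_interior_closedBall (by simp)⟩⟩

/-- The distance to the square is attained. -/
theorem exists_affine_cube {K : Set (Fin 2 → ℝ)} (hK : IsConvexBody K) {r : ℝ} (hr : 0 < r)
    (h : bmDist K (cube 2) = r) (hne : (bmSet K (cube 2)).Nonempty) :
    ∃ (B : (Fin 2 → ℝ) ≃L[ℝ] (Fin 2 → ℝ)) (c w : Fin 2 → ℝ),
      (∀ x ∈ K, ∃ s ∈ cube 2, B s + c = x) ∧ ∀ s ∈ cube 2, ∃ k ∈ K, r • k + w = B s + c := by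
  obtain ⟨hconv, hcomp, hint⟩ := hK
  obtain ⟨R, hR⟩ := hne
  have hcubec : IsCompact (cube 2) := (isConvexBody_cube 2).2.1
  let φ : (Fin 2 → ℝ) × (Fin 2 → ℝ) × (Fin 2 → ℝ) → (Fin 2 → ℝ) → (Fin 2 → ℝ) :=
    fun p s => p.1 + s 0 • p.2.1 + s 1 • p.2.2
  let S : Set (ℝ × (Fin 2 → ℝ) × (Fin 2 → ℝ) × (Fin 2 → ℝ) × (Fin 2 → ℝ)) := {p | p.1 ∈ Icc r R ∧
    (∀ x ∈ K, ∃ s ∈ cube 2, φ p.2.2 s = x) ∧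
    ∀ s ∈ cube 2, ∃ k ∈ K, p.1 • k + p.2.1 = φ p.2.2 s}
  have hmem : ∀ ρ ∈ bmSet K (cube 2), ρ ≤ R → ∃ q, (ρ, q) ∈ S := by
    intro ρ hρ hρR
    have hle : r ≤ ρ := h ▸ csInf_le (bddBelow_bmSet _ _) hρ
    obtain ⟨hρ0, T, u, v, h1, h2⟩ := mem_bmSet.1 hρ
    have hT : ∀ s : Fin 2 → ℝ, T v - u + s 0 • T (Pi.single 0 1) + s 1 • T (Pi.single 1 1)
        = T (s + v) - u := by
      intro s
      conv_rhs => rw [eq_smul_single_add_smul_single s]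
      simp only [map_add, map_smul]
      abel
    refine ⟨(ρ • u - u, T v - u, T (Pi.single 0 1), T (Pi.single 1 1)), ⟨hle, hρR⟩,
      fun x hx => ?_, fun s hs => ?_⟩
    · obtain ⟨s, hs, hsx⟩ := h1 x hx
      exact ⟨s, hs, by simp only [φ, hT, hsx, add_sub_cancel_right]⟩
    · obtain ⟨k, hk, hks⟩ := h2 s hs
      refine ⟨k, hk, ?_⟩
      simp only [φ, hT, ← hks, smul_add]
      abel
  have hclosed : IsClosed S := by
    have hS : S = (Prod.fst ⁻¹' Icc r R) ∩
        ((⋂ x ∈ K, {p | ∃ s ∈ cube 2, φ p.2.2 s = x}) ∩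
          ⋂ s ∈ cube 2, {p | ∃ k ∈ K, p.1 • k + p.2.1 = φ p.2.2 s}) := by
      ext p
      simp [S]
    rw [hS]
    refine (isClosed_Icc.preimage continuous_fst).inter (.inter ?_ ?_)
    · refine isClosed_biInter fun x _ => ?_
      exact isClosed_setOf_exists_mem hcubec
        (f := fun z : (ℝ × (Fin 2 → ℝ) × (Fin 2 → ℝ) × (Fin 2 → ℝ) × (Fin 2 → ℝ)) × (Fin 2 → ℝ) =>
          φ z.1.2.2 z.2) (g := fun _ => x) (by fun_prop) (by fun_prop)
    · refine isClosed_biInter fun s _ => ?_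
      exact isClosed_setOf_exists_mem hcomp
        (f := fun z : (ℝ × (Fin 2 → ℝ) × (Fin 2 → ℝ) × (Fin 2 → ℝ) × (Fin 2 → ℝ)) × (Fin 2 → ℝ) =>
          z.1.1 • z.2 + z.1.2.1) (g := fun z => φ z.1.2.2 s) (by fun_prop) (by fun_prop)
  obtain ⟨C, hC⟩ := hcomp.isBounded.exists_norm_le
  obtain ⟨x₀, hx₀⟩ := hint.mono interior_subset
  have hbdd : Bornology.IsBounded S := by
    have hC0 : 0 ≤ C := (norm_nonneg _).trans (hC x₀ hx₀)
    refine (isBounded_iff_forall_norm_le).2 ⟨R + 2 * (C + 2 * (R * C)), ?_⟩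
    rintro ⟨ρ, w, c, e, f⟩ ⟨⟨hρ, hρR⟩, h1, h2⟩
    dsimp only at hρ hρR h1 h2
    have hR0 : 0 < R := by linarith
    have hk : ∀ k ∈ K, ‖ρ • k‖ ≤ R * C := fun k hk => by
      rw [norm_smul, Real.norm_of_nonneg (by linarith)]
      exact mul_le_mul hρR (hC k hk) (norm_nonneg _) hR0.le
    have hw : ‖w‖ ≤ C + R * C := by
      obtain ⟨s, hs, hsx⟩ := h1 x₀ hx₀
      obtain ⟨k, hkK, hks⟩ := h2 s hs
      have : w = x₀ - ρ • k := by rw [← hsx, ← hks]; abel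
      rw [this]
      exact (norm_sub_le _ _).trans (add_le_add (hC _ hx₀) (hk k hkK))
    have hφ : ∀ s ∈ cube 2, ‖φ (c, e, f) s‖ ≤ C + 2 * (R * C) := by
      intro s hs
      obtain ⟨k, hkK, hks⟩ := h2 s hs
      rw [← hks]
      have := norm_add_le (ρ • k) w
      have := hk k hkK
      linarith
    have hc : ‖c‖ ≤ C + 2 * (R * C) := by
      simpa [φ] using hφ 0 (by intro i; simp)
    have he : ‖e‖ ≤ 2 * (C + 2 * (R * C)) := by
      have : e = φ (c, e, f) ![1, 0] - c := by simp [φ]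
      rw [this]
      refine (norm_sub_le _ _).trans ?_
      linarith [hφ ![1, 0] (by intro i; fin_cases i <;> simp)]
    have hf : ‖f‖ ≤ 2 * (C + 2 * (R * C)) := by
      have : f = φ (c, e, f) ![0, 1] - c := by simp [φ]
      rw [this]
      refine (norm_sub_le _ _).trans ?_
      linarith [hφ ![0, 1] (by intro i; fin_cases i <;> simp)]
    have hRC : 0 ≤ R * C := by positivity
    simp only [norm_prod_le_iff, Real.norm_of_nonneg (hr.le.trans hρ)]
    exact ⟨by linarith, by linarith, by linarith, by linarith, by linarith⟩
  have hScomp : IsCompact S := Metric.isCompact_of_isClosed_isBounded hclosed hbdd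
  obtain ⟨q, hq⟩ := hmem R hR le_rfl
  obtain ⟨⟨ρ, w, c, e, f⟩, hpS, hpmin⟩ := hScomp.exists_isMinOn ⟨_, hq⟩ continuous_fst.continuousOn
  have hρr : ρ = r := by
    refine le_antisymm ?_ hpS.1.1
    rw [← h]
    refine le_csInf ⟨R, hR⟩ fun ρ' hρ' => ?_
    by_cases hle : ρ' ≤ R
    · obtain ⟨q', hq'⟩ := hmem ρ' hρ' hle
      exact hpmin hq'
    · exact hpS.1.2.trans (not_le.1 hle).le
  subst hρr
  obtain ⟨-, h1, h2⟩ := hpS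
  let A : (Fin 2 → ℝ) →ₗ[ℝ] (Fin 2 → ℝ) :=
    (LinearMap.proj 0).smulRight e + (LinearMap.proj 1).smulRight f
  have hA : ∀ s, A s + c = φ (c, e, f) s := fun s => by 
    simp only [A, φ, LinearMap.add_apply, LinearMap.smulRight_apply, LinearMap.proj_apply]; abel
  have hsurj : Function.Surjective A := by
    rw [← LinearMap.range_eq_top]
    apply Submodule.eq_top_of_nonempty_interior'
    obtain ⟨z, hz⟩ := hint
    refine ⟨z - c, interior_maximal ?_ (isOpen_interior.sub_right (t := {c}))
      (sub_mem_sub hz rfl)⟩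
    rintro _ ⟨x, hx, _, rfl, rfl⟩
    obtain ⟨s, -, hs⟩ := h1 x (interior_subset hx)
    exact ⟨s, by rw [eq_sub_iff_add_eq, hA]; exact hs⟩
  let B := LinearEquiv.ofBijective A ⟨LinearMap.injective_iff_surjective.2 hsurj, hsurj⟩
  refine ⟨B.toContinuousLinearEquiv, c, w, fun x hx => ?_, fun s hs => ?_⟩
  · obtain ⟨s, hs, hsx⟩ := h1 x hx
    exact ⟨s, hs, (hA s).trans hsx⟩
  · obtain ⟨k, hk, hks⟩ := h2 s hs
    exact ⟨k, hk, hks.trans (hA s).symm⟩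

theorem abs_det_le_of_hexagon {a b c x y z l m : ℝ} (h1 : a + b + c = 0) (h2 : x + y + z = 0)
    (ha : |a| ≤ l) (hb : |b| ≤ l) (hc : |c| ≤ l) (hx : |x| ≤ l) (hy : |y| ≤ l) (hz : |z| ≤ l)
    (hax : |a| + |x| ≤ m) (hby : |b| + |y| ≤ m) (hcz : |c| + |z| ≤ m) :
    3 / 2 * |a * y - b * x| ≤ l * m := by
  have abs_eq : ∀ {a b c : ℝ}, a + b + c = 0 → 0 ≤ b * c → |a| = |b| + |c| := by
    intro a b c h hbc
    have : a = -(b + c) := by linarith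
    rw [this, abs_neg, abs_add_eq_add_abs_iff]
    rcases mul_nonneg_iff.1 hbc with h | h
    · exact Or.inl h
    · exact Or.inr h
  have same : ∀ {a b c x y z : ℝ}, a + b + c = 0 → x + y + z = 0 → |a| ≤ l → |x| ≤ l →
      |a| + |x| ≤ m → 0 ≤ b * c → 0 ≤ y * z → 3 / 2 * |b * z - c * y| ≤ l * m := by
    intro a b c x y z h1 h2 ha hx hax hbc hyz
    rw [abs_eq h1 hbc] at ha hax
    rw [abs_eq h2 hyz] at hx hax
    have hle := abs_sub (b * z) (c * y)
    rw [abs_mul, abs_mul] at hle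
    have hp := abs_nonneg b
    have hq := abs_nonneg c
    have hs := abs_nonneg y
    have ht := abs_nonneg z
    generalize |b| = p at *
    generalize |c| = q at *
    generalize |y| = s at *
    generalize |z| = t at *
    suffices 3 / 2 * (p * t + q * s) ≤ l * m by linarith
    nlinarith [mul_nonneg hp ht, mul_nonneg hq hs, mul_nonneg hp hs, mul_nonneg hq ht]
  have diff : ∀ {a b c x y z : ℝ}, a + b + c = 0 → x + y + z = 0 → |a| ≤ l → |y| ≤ l →
      |a| + |x| ≤ m → |b| + |y| ≤ m → |c| + |z| ≤ m → 0 ≤ b * c → 0 ≤ x * z →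
      3 / 2 * |a * y - b * x| ≤ l * m := by
    intro a b c x y z h1 h2 ha hy hax hby hcz hbc hxz
    have hD : a * y - b * x = b * z + c * x + c * z := by
      have : a = -(b + c) := by linarith
      have : y = -(x + z) := by linarith
      subst a y
      ring
    have hle : |a * y - b * x| ≤ |b| * |z| + |c| * |x| + |c| * |z| := by
      rw [hD, ← abs_mul, ← abs_mul, ← abs_mul]
      exact abs_add_three _ _ _
    rw [abs_eq h1 hbc] at ha hax
    rw [abs_eq (by linarith : y + x + z = 0) hxz] at hy hby
    have hp := abs_nonneg b
    have hq := abs_nonneg c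
    have hs := abs_nonneg x
    have ht := abs_nonneg z
    generalize |b| = p at *
    generalize |c| = q at *
    generalize |x| = s at *
    generalize |z| = t at *
    suffices 3 / 2 * (p * t + q * s + q * t) ≤ l * m by linarith
    rcases le_total t q with h | h <;>
    nlinarith [mul_nonneg hp ht, mul_nonneg hq hs, mul_nonneg hp hs, mul_nonneg hq ht,
      mul_nonneg hp (sub_nonneg.2 h), mul_nonneg hs (sub_nonneg.2 h),
      mul_nonneg ht (sub_nonneg.2 h), mul_nonneg hq (sub_nonneg.2 h)]
  have hpair : ∀ {a b c : ℝ}, a + b + c = 0 → 0 ≤ b * c ∨ 0 ≤ c * a ∨ 0 ≤ a * b := by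
    intro a b c h
    by_contra! hcon
    obtain ⟨h1, h2, h3⟩ := hcon
    have : a = -(b + c) := by linarith
    subst this
    nlinarith [sq_nonneg b, sq_nonneg c]
  have e1 : a * y - b * x = b * z - c * y := by
    have : a = -(b + c) := by linarith
    have : x = -(y + z) := by linarith
    subst a x
    ring
  have e2 : a * y - b * x = c * x - a * z := by
    have : b = -(a + c) := by linarith
    have : y = -(x + z) := by linarith
    subst b y
    ring
  rcases hpair h1 with hf | hf | hf <;> rcases hpair h2 with hg | hg | hg
  · rw [e1]
    exact same h1 h2 ha hx hax hf hg
  · exact diff h1 h2 ha hy hax hby hcz hf (by linarith)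
  · rw [e2, abs_sub_comm]
    exact diff (b := c) (by linarith) (by linarith) ha hz hax hcz hby (by linarith) hg
  · rw [abs_sub_comm]
    exact diff (c := c) (by linarith) (by linarith) hb hx hby hax hcz (by linarith) (by linarith)
  · rw [e2]
    exact same (by linarith) (by linarith) hb hy hby hf hg
  · rw [e1]
    exact diff (c := a) (by linarith) (by linarith) hb hz hby hcz hax (by linarith) (by linarith)
  · rw [e2]
    exact diff (c := b) (by linarith) (by linarith) hc hx hcz hax hby (by linarith) (by linarith)
  · rw [e1, abs_sub_comm]
    exact diff (c := a) (by linarith) (by linarith) hc hy hcz hby hax (by linarith) (by linarith)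
  · exact same (by linarith) (by linarith) hc hz hcz hf hg

/-- The affine regular hexagon. -/
def hexagon : Set (Fin 2 → ℝ) := {x | |x 0| ≤ 1 ∧ |x 1| ≤ 1 ∧ |x 0 - x 1| ≤ 1}

theorem isSymmetricBody_of_neg_mem {n : ℕ} {L : Set (Fin n → ℝ)} (h : ∀ x ∈ L, -x ∈ L) :
    IsSymmetricBody L := by
  refine ⟨0, Set.ext fun x => ⟨fun hx => ⟨-x, h x hx, by simp⟩, ?_⟩⟩
  rintro ⟨y, hy, rfl⟩
  simpa using h y hy

theorem isConvexBody_hexagon : IsConvexBody hexagon := by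
  have heq : hexagon = cube 2 ∩ {x | |x 0 - x 1| ≤ 1} := by
    ext x
    simp [hexagon, cube, and_assoc]
  have hcl : IsClosed {x : Fin 2 → ℝ | |x 0 - x 1| ≤ 1} := isClosed_le (by fun_prop) (by fun_prop)
  obtain ⟨h1, h2, -⟩ := isConvexBody_cube 2
  rw [heq]
  refine ⟨h1.inter ?_, h2.inter_right hcl, 0, ?_⟩
  · intro x hx y hy a b ha hb hab
    have hx : |x 0 - x 1| ≤ 1 := hx
    have hy : |y 0 - y 1| ≤ 1 := hy
    change |a * x 0 + b * y 0 - (a * x 1 + b * y 1)| ≤ 1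
    rw [abs_le] at *
    constructor <;> nlinarith
  · rw [interior_inter]
    refine ⟨mem_interior_cube (by simp), interior_maximal (t := {x : Fin 2 → ℝ | |x 0 - x 1| < 1})
      (fun x (hx : |x 0 - x 1| < 1) => hx.le) (isOpen_lt (by fun_prop) (by fun_prop)) (by simp)⟩

/-- A linear image of the hexagon which lies in `l • cube` and whose multiple by `m` contains the
cube satisfies `3 / 2 ≤ l * m`. -/
theorem three_halves_le_of_hexagon {l m : ℝ} (S : (Fin 2 → ℝ) ≃ₗ[ℝ] (Fin 2 → ℝ))
    (h1 : ∀ x ∈ hexagon, ∀ i, |S x i| ≤ l)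
    (h2 : ∀ x ∈ cube 2, |S.symm x 0| ≤ m ∧ |S.symm x 1| ≤ m ∧ |S.symm x 0 - S.symm x 1| ≤ m) :
    3 / 2 ≤ l * m := by
  have hS : ∀ x : Fin 2 → ℝ, ∀ i, S x i = S ![1, 0] i * x 0 + S ![0, 1] i * x 1 := by
    intro x i
    have : x = x 0 • ![1, 0] + x 1 • ![0, 1] := by ext i; fin_cases i <;> simp
    conv_lhs => rw [this]
    simp only [map_add, map_smul, Pi.add_apply, Pi.smul_apply, smul_eq_mul]
    ring
  have ha := h1 ![1, 0] (by simp [hexagon])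
  have hb := h1 ![0, 1] (by simp [hexagon])
  have hab := h1 ![1, 1] (by simp [hexagon])
  obtain ⟨p0, p1, p2⟩ := h2 ![1, 1] (by intro i; fin_cases i <;> simp)
  obtain ⟨q0, q1, q2⟩ := h2 ![1, -1] (by intro i; fin_cases i <;> simp)
  have hp : ∀ i, S (S.symm ![1, 1]) i = (![1, 1] : Fin 2 → ℝ) i := by simp
  have hq : ∀ i, S (S.symm ![1, -1]) i = (![1, -1] : Fin 2 → ℝ) i := by simp
  generalize S.symm ![1, 1] = p at *
  generalize S.symm ![1, -1] = q at *
  have hab0 := hS ![1, 1] 0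
  have hab1 := hS ![1, 1] 1
  have hp0 := hp 0
  have hp1 := hp 1
  have hq0 := hq 0
  have hq1 := hq 1
  rw [hS] at hp0 hp1 hq0 hq1
  have ha0 := ha 0
  have ha1 := ha 1
  have hb0 := hb 0
  have hb1 := hb 1
  have hc0 := hab 0
  have hc1 := hab 1
  simp at hab0 hab1 hp0 hp1 hq0 hq1
  rw [hab0] at hc0
  rw [hab1] at hc1
  generalize S ![1, 0] 0 = f0 at *
  generalize S ![1, 0] 1 = g0 at *
  generalize S ![0, 1] 0 = f1 at *
  generalize S ![0, 1] 1 = g1 at *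
  set D := f0 * g1 - f1 * g0 with hD
  have hDp0 : g1 - f1 = D * p 0 := by rw [hD]; linear_combination f1 * hp1 - g1 * hp0
  have hDp1 : f0 - g0 = D * p 1 := by rw [hD]; linear_combination g0 * hp0 - f0 * hp1
  have hDq0 : g1 + f1 = D * q 0 := by rw [hD]; linear_combination f1 * hq1 - g1 * hq0
  have hDq1 : -(f0 + g0) = D * q 1 := by rw [hD]; linear_combination g0 * hq0 - f0 * hq1
  have hD0 : D ≠ 0 := by
    intro h0
    rw [h0] at hDp0 hDp1 hDq0 hDq1
    have e1 : f0 = 0 := by linarith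
    have e2 : f1 = 0 := by linarith
    rw [e1, e2] at hp0
    simp at hp0
  have habs : ∀ s t x y : ℝ, s - t = D * x → s + t = D * y → |x| ≤ m → |y| ≤ m →
      |s| + |t| ≤ |D| * m := by
    intro s t x y hx hy hxm hym
    have h3 : |s - t| ≤ |D| * m := by
      rw [hx, abs_mul]; exact mul_le_mul_of_nonneg_left hxm (abs_nonneg _)
    have h4 : |s + t| ≤ |D| * m := by
      rw [hy, abs_mul]; exact mul_le_mul_of_nonneg_left hym (abs_nonneg _)
    rw [abs_le] at h3 h4
    rcases abs_cases s with h5 | h5 <;> rcases abs_cases t with h6 | h6 <;> linarith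
  have key := abs_det_le_of_hexagon (a := f0) (b := f1) (c := -(f0 + f1)) (x := g0) (y := g1)
    (z := -(g0 + g1)) (l := l) (m := |D| * m) (by ring) (by ring) ha0 hb0 (by rwa [abs_neg])
    ha1 hb1 (by rwa [abs_neg])
    (habs _ _ (p 1) (-q 1) hDp1 (by linarith) p1 (by rwa [abs_neg]))
    (habs _ _ (-p 0) (q 0) (by linarith) (by linarith) (by rwa [abs_neg]) q0)
    (by
      rw [abs_neg, abs_neg]
      exact habs _ _ (-(p 0 - p 1)) (q 0 - q 1) (by linarith) (by linarith)
        (by rwa [abs_neg]) q2)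
  have : 3 / 2 * |D| ≤ l * m * |D| := by linarith
  exact le_of_mul_le_mul_right this (abs_pos.2 hD0)

theorem neg_mem_hexagon : ∀ x ∈ hexagon, -x ∈ hexagon := by
  rintro x ⟨h0, h1, h2⟩
  refine ⟨by simpa using h0, by simpa using h1, ?_⟩
  rw [abs_sub_comm] at h2
  simpa [neg_add_eq_sub] using h2

theorem three_halves_le_mul_of_mem_bmSet {K : Set (Fin 2 → ℝ)} {ρ₁ ρ₂ : ℝ}
    (h₁ : ρ₁ ∈ bmSet K (cube 2)) (h₂ : ρ₂ ∈ bmSet K hexagon) : 3 / 2 ≤ ρ₁ * ρ₂ := by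
  obtain ⟨hρ₁, T₁, u₁, v₁, h1, h1'⟩ := mem_bmSet.1 h₁
  obtain ⟨hρ₂, T₂, u₂, v₂, h2, h2'⟩ := mem_bmSet.1 h₂
  have hsymm : ∀ {a b m : ℝ}, |a + b| ≤ m → |-a + b| ≤ m → |a| ≤ m := by
    intro a b m h h'
    rw [abs_le] at *
    constructor <;> linarith
  rw [mul_comm]
  refine three_halves_le_of_hexagon (T₂.trans T₁.symm) ?_ ?_
  · have key : ∃ b : Fin 2 → ℝ, ∀ x ∈ hexagon, ∀ i, |T₁.symm (T₂ x) i + b i| ≤ ρ₂ := by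
      refine ⟨T₁.symm (T₂ v₂ - ρ₂ • u₂ + ρ₂ • u₁) - ρ₂ • v₁, fun x hx i => ?_⟩
      obtain ⟨k, hk, hkx⟩ := h2' x hx
      obtain ⟨s, hs, hsk⟩ := h1 k hk
      have : T₁.symm (T₂ x) + (T₁.symm (T₂ v₂ - ρ₂ • u₂ + ρ₂ • u₁) - ρ₂ • v₁) = ρ₂ • s := by
        apply T₁.injective
        simp only [map_add, map_sub, map_smul, LinearEquiv.apply_symm_apply] at hkx hsk ⊢
        have e1 : T₂ x = ρ₂ • (k + u₂) - T₂ v₂ := by rw [hkx]; abel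
        have e2 : T₁ s = k + u₁ - T₁ v₁ := by rw [← hsk]; abel
        rw [e1, e2]
        module
      calc |_| = |ρ₂ * s i| := by
            rw [← Pi.add_apply, this]; rfl
        _ = ρ₂ * |s i| := by rw [abs_mul, abs_of_pos hρ₂]
        _ ≤ ρ₂ := mul_le_of_le_one_right hρ₂.le (hs i)
    obtain ⟨b, hb⟩ := key
    intro x hx i
    have h3 := hb (-x) (neg_mem_hexagon x hx) i
    simp only [map_neg, Pi.neg_apply] at h3
    exact hsymm (hb x hx i) h3
  · have key : ∃ b : Fin 2 → ℝ, ∀ x ∈ cube 2, ∃ y ∈ hexagon, T₂.symm (T₁ x) + b = ρ₁ • y := by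
      refine ⟨T₂.symm (T₁ v₁ - ρ₁ • u₁ + ρ₁ • u₂) - ρ₁ • v₂, fun x hx => ?_⟩
      obtain ⟨k, hk, hkx⟩ := h1' x hx
      obtain ⟨s, hs, hsk⟩ := h2 k hk
      refine ⟨s, hs, T₂.injective ?_⟩
      simp only [map_add, map_sub, map_smul, LinearEquiv.apply_symm_apply] at hkx hsk ⊢
      have e1 : T₁ x = ρ₁ • (k + u₁) - T₁ v₁ := by rw [hkx]; abel
      have e2 : T₂ s = k + u₂ - T₂ v₂ := by rw [← hsk]; abel
      rw [e1, e2]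
      module
    obtain ⟨b, hb⟩ := key
    intro x hx
    obtain ⟨y, ⟨y0, y1, y2⟩, hy⟩ := hb x hx
    obtain ⟨z, ⟨z0, z1, z2⟩, hz⟩ := hb (-x) fun i => by simpa using hx i
    rw [map_neg, map_neg] at hz
    have hscale : ∀ {t : ℝ}, |t| ≤ 1 → |ρ₁ * t| ≤ ρ₁ := fun ht => by
      rw [abs_mul, abs_of_pos hρ₁]
      exact mul_le_of_le_one_right hρ₁.le ht
    have hyi : ∀ i, T₂.symm (T₁ x) i + b i = ρ₁ * y i := fun i => congrFun hy i
    have hzi : ∀ i, -T₂.symm (T₁ x) i + b i = ρ₁ * z i := fun i => congrFun hz i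
    refine ⟨hsymm (hyi 0 ▸ hscale y0) (hzi 0 ▸ hscale z0),
      hsymm (hyi 1 ▸ hscale y1) (hzi 1 ▸ hscale z1),
      hsymm (b := b 0 - b 1) ?_ ?_⟩
    · convert hscale y2 using 2
      simp only [LinearEquiv.trans_symm, LinearEquiv.symm_symm, LinearEquiv.trans_apply]
      linarith [hyi 0, hyi 1]
    · convert hscale z2 using 2
      simp only [LinearEquiv.trans_symm, LinearEquiv.symm_symm, LinearEquiv.trans_apply]
      linarith [hzi 0, hzi 1]

theorem sqrt_three_halves_le_of_bmDist_eq {K : Set (Fin 2 → ℝ)} (hK : IsConvexBody K) {r : ℝ}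
    (h₁ : bmDist K (cube 2) = r) (h₂ : bmDist K hexagon = r) : Real.sqrt (3 / 2) ≤ r := by
  by_contra! hlt
  obtain ⟨ρ₁, hρ₁, hlt₁⟩ := exists_lt_of_csInf_lt (bmSet_nonempty hK (isConvexBody_cube 2))
    (h₁.trans_lt hlt)
  obtain ⟨ρ₂, hρ₂, hlt₂⟩ := exists_lt_of_csInf_lt (bmSet_nonempty hK isConvexBody_hexagon)
    (h₂.trans_lt hlt)
  have h3 := three_halves_le_mul_of_mem_bmSet hρ₁ hρ₂
  have h4 := mul_lt_mul'' hlt₁ hlt₂ hρ₁.1.le hρ₂.1.le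
  rw [Real.mul_self_sqrt (by norm_num)] at h4
  linarith

/-- if a planar convex body `K` is equidistant (with distance `r`) to
all symmetric convex bodies, then `r ≥ √(3/2)`, and `K` is neither smooth nor
strictly convex. -/
theorem stmt18 (K : Set (Fin 2 → ℝ)) (hK : IsConvexBody K) (r : ℝ)
    (h : ∀ L : Set (Fin 2 → ℝ), IsConvexBody L → IsSymmetricBody L → bmDist K L = r) :
    Real.sqrt (3/2) ≤ r ∧
    (∃ x ∈ frontier K, ∃ f g : (Fin 2 → ℝ) →ₗ[ℝ] ℝ,
      f ≠ 0 ∧ g ≠ 0 ∧ (¬ ∃ c : ℝ, g = c • f) ∧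
      (∀ y ∈ K, f y ≤ f x) ∧ (∀ y ∈ K, g y ≤ g x)) ∧
    (∃ a b : Fin 2 → ℝ, a ≠ b ∧ a ∈ frontier K ∧ b ∈ frontier K ∧
      segment ℝ a b ⊆ frontier K) := by
  have hcube : IsSymmetricBody (cube 2) :=
    isSymmetricBody_of_neg_mem fun x hx i => by simpa using hx i
  have hhex : IsSymmetricBody hexagon := isSymmetricBody_of_neg_mem neg_mem_hexagon
  have hdc := h _ (isConvexBody_cube 2) hcube
  have hsqrt := sqrt_three_halves_le_of_bmDist_eq hK hdc (h _ isConvexBody_hexagon hhex)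
  have hr : 1 < r := lt_of_lt_of_le (Real.lt_sqrt_of_sq_lt (by norm_num)) hsqrt
  refine ⟨hsqrt, ?_⟩
  obtain ⟨B, c, w, h1, h2⟩ := exists_affine_cube hK (by linarith) hdc
    (bmSet_nonempty hK (isConvexBody_cube 2))
  let φ : (Fin 2 → ℝ) ≃ₜ (Fin 2 → ℝ) := B.toHomeomorph.trans (Homeomorph.addRight c)
  have hφ : ∀ s, φ s = B s + c := fun s => rfl
  have hφcombo : ∀ (x y : Fin 2 → ℝ) (a b : ℝ), a + b = 1 →
      φ (a • x + b • y) = a • φ x + b • φ y := by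
    intro x y a b hab
    obtain rfl : b = 1 - a := by linarith
    simp only [hφ, map_add, map_smul]
    module
  have hψ : ∀ y, φ.symm y = B.symm (y - c) := by
    intro y
    rw [Homeomorph.symm_apply_eq, hφ, B.apply_symm_apply, sub_add_cancel]
  have hconv : Convex ℝ (φ ⁻¹' K) := by
    intro x hx y hy a b ha hb hab
    rw [mem_preimage, hφcombo _ _ _ _ hab]
    exact hK.1 hx hy ha hb hab
  have hcomp : IsCompact (φ ⁻¹' K) := φ.isCompact_preimage.2 hK.2.1
  have hsub1 : φ ⁻¹' K ⊆ cube 2 := by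
    intro x hx
    obtain ⟨s, hs, hsx⟩ := h1 _ hx
    rwa [← φ.injective (hsx : φ s = φ x)]
  have hsub2 : cube 2 ⊆ (fun k => r • k + B.symm (r • c + w - c)) '' (φ ⁻¹' K) := by
    intro s hs
    obtain ⟨k, hk, hks⟩ := h2 s hs
    refine ⟨φ.symm k, by simpa using hk, B.injective ?_⟩
    simp only [hψ, map_add, map_smul, ContinuousLinearEquiv.apply_symm_apply]
    rw [eq_sub_of_add_eq hks.symm]
    module
  have hmin : ∀ ρ : ℝ, 0 < ρ → ∀ w' : Fin 2 → ℝ,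
      (∀ x ∈ φ ⁻¹' K, -x ∈ (fun k => ρ • k + w') '' (φ ⁻¹' K)) → r ≤ ρ := by
    intro ρ hρ w' hw'
    rw [← h _ (isConvexBody_sub_self hK) (isSymmetricBody_sub_self K)]
    refine bmDist_sub_self_le hρ (w := B w' - ρ • c - c) (fun x hx => ?_) hK.1
    obtain ⟨k, hk, hkx⟩ := hw' (φ.symm x) (by simpa using hx)
    refine ⟨φ k, hk, ?_⟩
    have h3 := congrArg B hkx
    simp only [hψ, map_add, map_smul, map_neg, ContinuousLinearEquiv.apply_symm_apply] at h3
    simp only [hφ]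
    have h4 : -x = -(x - c) - c := by abel
    rw [h4, ← h3]
    module
  have hfront : ∀ x, x ∈ frontier (φ ⁻¹' K) → φ x ∈ frontier K := by
    intro x hx
    rwa [← φ.preimage_frontier] at hx
  constructor
  · obtain ⟨x, hx, f, g, hf, hg, hfg, hfx, hgx⟩ :=
      not_smooth_of_subset_cube hconv hcomp hr hsub1 hsub2 hmin
    have hcomp_apply : ∀ (f : (Fin 2 → ℝ) →ₗ[ℝ] ℝ) (y : Fin 2 → ℝ),
        (f ∘ₗ (B.symm : (Fin 2 → ℝ) →ₗ[ℝ] (Fin 2 → ℝ))) (B y) = f y := fun f y => by simp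
    have hne : ∀ f : (Fin 2 → ℝ) →ₗ[ℝ] ℝ, f ≠ 0 →
        f ∘ₗ (B.symm : (Fin 2 → ℝ) →ₗ[ℝ] (Fin 2 → ℝ)) ≠ 0 := by
      intro f hf h0
      refine hf (LinearMap.ext fun y => ?_)
      rw [← hcomp_apply, h0]
      rfl
    have hmax : ∀ f : (Fin 2 → ℝ) →ₗ[ℝ] ℝ, (∀ y ∈ φ ⁻¹' K, f y ≤ f x) →
        ∀ y ∈ K, (f ∘ₗ (B.symm : (Fin 2 → ℝ) →ₗ[ℝ] (Fin 2 → ℝ))) y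
          ≤ (f ∘ₗ (B.symm : (Fin 2 → ℝ) →ₗ[ℝ] (Fin 2 → ℝ))) (φ x) := by
      intro f hf y hy
      obtain ⟨z, rfl⟩ := φ.surjective y
      simp only [hφ, map_add, hcomp_apply]
      linarith [hf z hy]
    refine ⟨φ x, hfront x hx, _, _, hne f hf, hne g hg, ?_, hmax f hfx, hmax g hgx⟩
    rintro ⟨t, ht⟩
    refine hfg ⟨t, LinearMap.ext fun y => ?_⟩
    rw [← hcomp_apply, ht, LinearMap.smul_apply, hcomp_apply, LinearMap.smul_apply]
  · obtain ⟨a, b, hab, ha, hb, hseg⟩ :=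
      not_strictConvex_of_subset_cube hconv hcomp hr hsub1 hsub2 hmin
    refine ⟨φ a, φ b, φ.injective.ne hab, hfront a ha, hfront b hb, ?_⟩
    rintro _ ⟨s, t, hs, ht, hst, rfl⟩
    rw [← hφcombo _ _ _ _ hst]
    exact hfront _ (hseg ⟨s, t, hs, ht, hst, rfl⟩)
end
end

section
/- Let K ⊆ ℝ² be a convex body with d_BM(K, C₂) = as(K), where C₂ = {x ∈ ℝ² : |x₁| ≤ 1, |x₂| ≤ 1} is the square. Then K is not smooth (some boundary point of K admits two distinct supporting lines) and not strictly convex (the boundary of K contains a nondegenerate segment). -/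
open Set Pointwise

noncomputable section

section Convexity

variable {E : Type*} [NormedAddCommGroup E] [NormedSpace ℝ E]

/-- Starting at a point of an open set one can move a little in any direction. -/
lemma IsOpen.exists_pos_add_smul_mem {U : Set E} (hU : IsOpen U) {x : E} (hx : x ∈ U) (d : E) :
    ∃ ε : ℝ, 0 < ε ∧ x + ε • d ∈ U := by
  have hc : Continuous fun ε : ℝ => x + ε • d := by fun_prop
  have h0 : ∀ᶠ ε in nhds (0 : ℝ), x + ε • d ∈ U :=
    hc.continuousAt.eventually_mem (hU.mem_nhds (by simpa using hx))
  obtain ⟨δ, hδ, hb⟩ := Metric.eventually_nhds_iff.1 h0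
  refine ⟨δ / 2, by positivity, hb ?_⟩
  rw [Real.dist_eq, sub_zero, abs_of_pos (by positivity)]
  linarith

/-- A compact subset of a convex set which can be moved pointwise into the interior along a
continuous displacement field can be moved there uniformly. -/
lemma IsCompact.exists_uniform_move {K M : Set E} (hK : IsCompact K) (hM : Convex ℝ M)
    (hKM : K ⊆ M) {g : E → E} (hg : Continuous g)
    (h : ∀ y ∈ K, ∃ ε : ℝ, 0 < ε ∧ y + ε • g y ∈ interior M) :
    ∃ ε : ℝ, 0 < ε ∧ ∀ y ∈ K, y + ε • g y ∈ interior M := by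
  suffices H : ∃ ε : ℝ, 0 < ε ∧ ∀ y ∈ K, ∀ δ : ℝ, 0 < δ → δ ≤ ε → y + δ • g y ∈ interior M by
    obtain ⟨ε, hε, H⟩ := H
    exact ⟨ε, hε, fun y hy => H y hy ε hε le_rfl⟩
  refine hK.induction_on (p := fun S => ∃ ε : ℝ, 0 < ε ∧ ∀ y ∈ S, ∀ δ : ℝ, 0 < δ → δ ≤ ε →
    y + δ • g y ∈ interior M) ⟨1, one_pos, by simp⟩ ?_ ?_ ?_
  · rintro S S' hSS ⟨ε, hε, H⟩
    exact ⟨ε, hε, fun y hy => H y (hSS hy)⟩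
  · rintro S S' ⟨ε, hε, H⟩ ⟨ε', hε', H'⟩
    refine ⟨min ε ε', lt_min hε hε', ?_⟩
    rintro y (hy | hy) δ hδ hle
    · exact H y hy δ hδ (hle.trans (min_le_left _ _))
    · exact H' y hy δ hδ (hle.trans (min_le_right _ _))
  · intro y hy
    obtain ⟨ε, hε, hyε⟩ := h y hy
    have hc : Continuous fun z => z + ε • g z := by fun_prop
    refine ⟨_, inter_mem_nhdsWithin K ((isOpen_interior.preimage hc).mem_nhds hyε), ε, hε, ?_⟩
    rintro z ⟨hzK, hz⟩ δ hδ hle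
    have := hM.add_smul_mem_interior (hKM hzK) hz (t := δ / ε)
      ⟨by positivity, (div_le_one hε).2 hle⟩
    rwa [smul_smul, div_mul_cancel₀ _ hε.ne'] at this

/-- A convex set with nonempty interior has a supporting functional at every point outside its
interior. -/
lemma Convex.exists_supporting {M : Set E} (hM : Convex ℝ M) (hne : (interior M).Nonempty) {y : E}
    (hy : y ∉ interior M) : ∃ f : E →ₗ[ℝ] ℝ, f ≠ 0 ∧ ∀ z ∈ M, f z ≤ f y := by
  obtain ⟨f, hf⟩ := geometric_hahn_banach_open_point hM.interior isOpen_interior hy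
  refine ⟨f.toLinearMap, ?_, fun z hz => ?_⟩
  · rintro h0
    obtain ⟨x, hx⟩ := hne
    have h1 : ∀ x, f x = 0 := fun x => LinearMap.congr_fun h0 x
    have := hf x hx
    rw [h1, h1] at this
    exact lt_irrefl _ this
  · have hz' : z ∈ closure (interior M) := by
      rw [hM.closure_interior_eq_closure_of_nonempty_interior hne]
      exact subset_closure hz
    have hcl : IsClosed {z | f z ≤ f y} := isClosed_le f.continuous continuous_const
    exact closure_minimal (fun a ha => (hf a ha).le) hcl hz'

/-- A maximizer of a nonzero functional on a set lies on its frontier. -/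
lemma mem_frontier_of_isMax {M : Set E} {f : E →ₗ[ℝ] ℝ} (hf : f ≠ 0) {x : E} (hx : x ∈ M)
    (hmax : ∀ z ∈ M, f z ≤ f x) : x ∈ frontier M := by
  refine ⟨subset_closure hx, fun hi => hf (LinearMap.ext fun d => ?_)⟩
  obtain ⟨ε, hε, h1⟩ := isOpen_interior.exists_pos_add_smul_mem hi (f d • d)
  have := hmax _ (interior_subset h1)
  simp only [map_add, map_smul, smul_eq_mul] at this
  have h2 : f d * f d ≤ 0 := by
    by_contra! hc
    have := mul_pos hε hc
    linarith
  simpa using mul_self_eq_zero.1 (le_antisymm h2 (mul_self_nonneg _))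

lemma Convex.image_sub_smul {K : Set E} (hK : Convex ℝ K) (w : E) (s : ℝ) :
    Convex ℝ ((fun k => w - s • k) '' K) := by
  rintro _ ⟨a, ha, rfl⟩ _ ⟨b, hb, rfl⟩ p q hp hq hpq
  refine ⟨p • a + q • b, hK ha hb hp hq hpq, ?_⟩
  have : w = p • w + q • w := by rw [← add_smul, hpq, one_smul]
  simp only
  nth_rewrite 1 [this]
  module

/-- If `K` can be pushed into the interior of a homothetic copy of `-K` of ratio `s`, then it fits
into one of strictly smaller ratio. -/
lemma exists_lt_ratio {K : Set E} (hK : Convex ℝ K) (hKc : IsCompact K) {s : ℝ} (hs : 0 < s)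
    {w : E} (hsub : K ⊆ (fun k => w - s • k) '' K) (t : E)
    (ht : ∀ y ∈ K, ∃ ε : ℝ, 0 < ε ∧ y + ε • t ∈ interior ((fun k => w - s • k) '' K)) :
    ∃ r : ℝ, 0 < r ∧ r < s ∧ ∃ c : E, ∀ k ∈ K, ∃ k' ∈ K, k = c - r • k' := by
  set M := (fun k => w - s • k) '' K with hMdef
  have hM : Convex ℝ M := hK.image_sub_smul w s
  obtain ⟨ε, -, h1⟩ := hKc.exists_uniform_move hM hsub (g := fun _ => t) continuous_const ht
  obtain ⟨δ, hδ, h2⟩ := (hKc.image (f := fun y => y + ε • t) (by fun_prop)).exists_uniform_move hM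
    (by rintro _ ⟨y, hy, rfl⟩; exact interior_subset (h1 y hy)) (g := id) continuous_id
    (by
      rintro _ ⟨y, hy, rfl⟩
      exact isOpen_interior.exists_pos_add_smul_mem (h1 y hy) _)
  have hδ' : (1 + δ) ≠ 0 := by positivity
  refine ⟨s / (1 + δ), by positivity, div_lt_self hs (by linarith),
    (1 + δ)⁻¹ • w - ε • t, fun k hk => ?_⟩
  obtain ⟨k', hk', he⟩ := interior_subset (h2 _ ⟨k, hk, rfl⟩)
  refine ⟨k', hk', ?_⟩
  have he' : (1 + δ)⁻¹ • (w - s • k') = k + ε • t := by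
    simp only at he
    rw [he]
    simp only [id]
    rw [show k + ε • t + δ • (k + ε • t) = (1 + δ) • (k + ε • t) by module,
      inv_smul_smul₀ hδ']
  rw [smul_sub, smul_smul, inv_mul_eq_div] at he'
  rw [sub_right_comm, he', add_sub_cancel_right]

end Convexity

lemma asymConst_le {n : ℕ} {K : Set (Fin n → ℝ)} (hK : Convex ℝ K) (hne : (interior K).Nonempty)
    {r : ℝ} (hr : 0 < r) (c : Fin n → ℝ) (h : ∀ k ∈ K, ∃ k' ∈ K, k = c - r • k') :
    asymConst K ≤ r := by
  have hr1 : (1 + r) ≠ 0 := by positivity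
  refine csInf_le ⟨0, fun _ hx => hx.1.le⟩ ⟨hr, (1 + r)⁻¹ • c, ?_, ?_⟩
  · obtain ⟨x, hx⟩ := hne
    obtain ⟨y, hy, hxy⟩ := h x (interior_subset hx)
    have := hK.combo_interior_self_mem_interior hx hy (a := (1 + r)⁻¹) (b := (1 + r)⁻¹ * r)
      (by positivity) (by positivity) (by field_simp)
    rwa [hxy, mul_smul, ← smul_add, sub_add_cancel] at this
  · rintro _ ⟨k, hk, rfl⟩
    obtain ⟨k', hk', rfl⟩ := h k hk
    refine ⟨_, ⟨k', hk', rfl⟩, ?_⟩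
    ext i
    simp
    field_simp
    ring

section Square

lemma cube_eq_closedBall (n : ℕ) : cube n = Metric.closedBall 0 1 := by
  ext x
  simp [cube, pi_norm_le_iff_of_nonneg]

lemma neg_mem_cube {n : ℕ} {x : Fin n → ℝ} (hx : x ∈ cube n) : -x ∈ cube n := by
  intro i
  simpa using hx i

lemma mem_interior_of_abs_lt {n : ℕ} {M : Set (Fin n → ℝ)} (hM : cube n ⊆ M) {x : Fin n → ℝ}
    (hx : ∀ i, |x i| < 1) : x ∈ interior M := by
  have : Metric.ball (0 : Fin n → ℝ) 1 ⊆ interior M :=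
    interior_maximal (Metric.ball_subset_closedBall.trans (cube_eq_closedBall n ▸ hM))
      Metric.isOpen_ball
  apply this
  simpa [pi_norm_lt_iff] using hx

lemma linearMap_apply_two (f : (Fin 2 → ℝ) →ₗ[ℝ] ℝ) {i j : Fin 2} (hij : i ≠ j)
    (x : Fin 2 → ℝ) : f x = x i * f (Pi.single i 1) + x j * f (Pi.single j 1) := by
  have hx : x = x i • Pi.single i 1 + x j • Pi.single j 1 := by
    ext k
    fin_cases i <;> fin_cases j <;> fin_cases k <;> simp_all
  nth_rewrite 1 [hx]
  simp

/-- Moving along the `j`-th axis within the square. -/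
lemma add_single_mem_cube {y : Fin 2 → ℝ} (hy : y ∈ cube 2) {j : Fin 2} {δ : ℝ}
    (hδ : |y j + δ| ≤ 1) : y + Pi.single j δ ∈ cube 2 := by
  intro k
  by_cases hk : k = j
  · subst hk
    simpa using hδ
  · simpa [hk] using hy k

variable {K : Set (Fin 2 → ℝ)} {s : ℝ} {w : Fin 2 → ℝ}

/-- A contact point in the relative interior of an edge of the square forces the outer body to lie
on one side of that edge. -/
lemma mul_le_one_of_contact {M : Set (Fin 2 → ℝ)} (hM : Convex ℝ M) (hC : cube 2 ⊆ M)
    {y : Fin 2 → ℝ} (hy : y ∈ cube 2) (hyM : y ∉ interior M) {i j : Fin 2} (hij : i ≠ j) {σ : ℝ}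
    (hσ : |σ| = 1) (hyi : y i = σ) (hyj : |y j| < 1) {z : Fin 2 → ℝ} (hz : z ∈ M) :
    σ * z i ≤ 1 := by
  obtain ⟨f, hf0, hf⟩ := hM.exists_supporting ⟨0, mem_interior_of_abs_lt hC (by simp)⟩ hyM
  have hσσ : σ * σ = 1 := by rw [← abs_mul_abs_self, hσ, one_mul]
  obtain ⟨h1, h2⟩ := abs_lt.1 hyj
  have hp := hf _ (hC (add_single_mem_cube hy (j := j) (δ := 1 - y j) (by simp)))
  have hm := hf _ (hC (add_single_mem_cube hy (j := j) (δ := -1 - y j) (by simp)))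
  have h0 := hf _ (hC (add_single_mem_cube hy (j := i) (δ := -y i) (by simp)))
  have hz' := hf z hz
  rw [linearMap_apply_two f hij, linearMap_apply_two f hij y] at hp hm h0 hz'
  simp [hij, hij.symm] at hp hm h0
  have hfj : f (Pi.single j 1) = 0 := by
    apply le_antisymm <;> nlinarith
  have hfi : f (Pi.single i 1) ≠ 0 := by
    intro hfi
    refine hf0 (LinearMap.ext fun x => ?_)
    rw [linearMap_apply_two f hij, hfi, hfj]
    simp
  rw [hfj, hyi] at hz'
  rw [hyi] at h0
  have hpos : 0 < σ * f (Pi.single i 1) :=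
    lt_of_le_of_ne h0 (mul_ne_zero (by rintro rfl; simp at hσ) hfi).symm
  have : (σ * f (Pi.single i 1)) * (σ * z i) ≤ (σ * f (Pi.single i 1)) * 1 := by
    calc (σ * f (Pi.single i 1)) * (σ * z i) = (σ * σ) * (z i * f (Pi.single i 1)) := by ring
      _ ≤ _ := by rw [hσσ]; linarith
  exact le_of_mul_le_mul_left this hpos

/-- In the symmetric case every vertex of the square belongs to the body. -/
lemma vertex_mem_of_ratio_le_one (hKC : K ⊆ cube 2)
    (hC : cube 2 ⊆ (fun k => w - s • k) '' K) (hs : 0 < s) (hs1 : s ≤ 1)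
    {v : Fin 2 → ℝ} (hv : ∀ i, |v i| = 1) : v ∈ K := by
  have hvC : v ∈ cube 2 := fun i => (hv i).le
  obtain ⟨k, hk, hk1⟩ := hC hvC
  obtain ⟨k', hk', hk2⟩ := hC (neg_mem_cube hvC)
  have : k' = v := by
    ext i
    have e1 := congrFun hk1 i
    have e2 := congrFun hk2 i
    simp at e1 e2
    obtain ⟨a1, a2⟩ := abs_le.1 (hKC hk i)
    obtain ⟨b1, b2⟩ := abs_le.1 (hKC hk' i)
    rcases (abs_eq one_pos.le).1 (hv i) with h | h <;> rw [h] at e1 e2 ⊢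
    · have : s * (k' i - k i) = 2 := by linarith
      nlinarith
    · have : s * (k i - k' i) = 2 := by linarith
      nlinarith
  exact this ▸ hk'

/-- If the ratio is optimal, the inner body contains a vertex of the square. -/
lemma exists_vertex_mem (hK : Convex ℝ K) (hKc : IsCompact K) (hKC : K ⊆ cube 2)
    (hs : 0 < s) (hC : cube 2 ⊆ (fun k => w - s • k) '' K)
    (hopt : ∀ r : ℝ, 0 < r → ∀ c, (∀ k ∈ K, ∃ k' ∈ K, k = c - r • k') → s ≤ r) :
    ∃ v ∈ K, ∀ i, |v i| = 1 := by
  by_contra! hno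
  have hs1 : 1 < s := by
    by_contra! hs1
    obtain ⟨i, hi⟩ := hno 1 (vertex_mem_of_ratio_le_one hKC hC hs hs1 (by simp))
    simp at hi
  set M := (fun k => w - s • k) '' K with hMdef
  have hM : Convex ℝ M := hK.image_sub_smul w s
  have hdir : ∀ i : Fin 2, ∃ τ : ℝ, |τ| = 1 ∧ ∀ y ∈ K, y ∉ interior M → y i ≠ τ := by
    intro i
    by_contra! hcon
    obtain ⟨y, hy, hyM, hy1⟩ := hcon 1 (by simp)
    obtain ⟨y', hy', hyM', hy1'⟩ := hcon (-1) (by simp)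
    obtain ⟨j, hij⟩ : ∃ j : Fin 2, i ≠ j := (exists_ne i).imp fun _ h => h.symm
    have hlt : ∀ z ∈ K, |z i| = 1 → |z j| < 1 := by
      intro z hz hzi
      refine lt_of_le_of_ne (hKC hz j) fun hzj => ?_
      obtain ⟨l, hl⟩ := hno z hz
      apply hl
      have : l = i ∨ l = j := by omega
      rcases this with rfl | rfl <;> assumption
    have h1 := mul_le_one_of_contact hM hC (hKC hy) hyM hij (σ := 1) (by simp) hy1
      (hlt y hy (by simp [hy1])) (z := w - s • y') ⟨y', hy', rfl⟩
    have h2 := mul_le_one_of_contact hM hC (hKC hy') hyM' hij (σ := -1) (by simp) hy1'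
      (hlt y' hy' (by simp [hy1'])) (z := w - s • y) ⟨y, hy, rfl⟩
    simp [hy1, hy1'] at h1 h2
    linarith
  choose τ hτ hne using hdir
  obtain ⟨r, hr, hrs, c, hc⟩ := exists_lt_ratio hK hKc hs (hKC.trans hC) τ (by
    intro y hy
    by_cases hyM : y ∈ interior M
    · exact isOpen_interior.exists_pos_add_smul_mem hyM _
    · have hp : ∀ i, 0 < |τ i - y i| := fun i => abs_pos.2 (sub_ne_zero.2 (hne i y hy hyM).symm)
      have hm : 0 < min |τ 0 - y 0| |τ 1 - y 1| := lt_min (hp 0) (hp 1)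
      have hlt : ∀ i, min |τ 0 - y 0| |τ 1 - y 1| / 2 < |τ i - y i| := by
        intro i
        refine (half_lt_self hm).trans_le ?_
        fin_cases i <;> simp
      refine ⟨_, half_pos hm, mem_interior_of_abs_lt hC fun i => ?_⟩
      have h1 := hlt i
      have h2 := half_pos hm
      have h3 := abs_le.1 (hKC hy i)
      generalize min |τ 0 - y 0| |τ 1 - y 1| / 2 = ε at h1 h2
      simp only [Pi.add_apply, Pi.smul_apply, smul_eq_mul]
      rcases (abs_eq one_pos.le).1 (hτ i) with h | h <;> rw [h] at h1 ⊢
      · rw [abs_of_nonneg (by linarith)] at h1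
        rw [abs_lt]
        constructor <;> linarith
      · rw [abs_of_nonpos (by linarith)] at h1
        rw [abs_lt]
        constructor <;> linarith)
  exact absurd (hopt r hr c hc) (not_le.2 hrs)

/-- If the ratio is optimal, some functional has two distinct maximizers on the inner body. -/
lemma exists_two_maximizers (hK : Convex ℝ K) (hKc : IsCompact K) (hKC : K ⊆ cube 2)
    (hs : 0 < s) (hC : cube 2 ⊆ (fun k => w - s • k) '' K)
    (hopt : ∀ r : ℝ, 0 < r → ∀ c, (∀ k ∈ K, ∃ k' ∈ K, k = c - r • k') → s ≤ r) :
    ∃ f : (Fin 2 → ℝ) →ₗ[ℝ] ℝ, f ≠ 0 ∧ ∃ a ∈ K, ∃ b ∈ K, a ≠ b ∧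
      (∀ z ∈ K, f z ≤ f a) ∧ ∀ z ∈ K, f z ≤ f b := by
  by_contra! hno
  have huniq : ∀ f : (Fin 2 → ℝ) →ₗ[ℝ] ℝ, f ≠ 0 → ∀ a ∈ K, ∀ b ∈ K,
      (∀ z ∈ K, f z ≤ f a) → (∀ z ∈ K, f z ≤ f b) → a = b := by
    intro f hf a ha b hb hfa hfb
    by_contra hab
    obtain ⟨z, hz, hlt⟩ := hno f hf a ha b hb hab hfa
    exact absurd (hfb z hz) (not_le.2 hlt)
  have hs1 : 1 < s := by
    by_contra! hs1
    have h1 := vertex_mem_of_ratio_le_one hKC hC hs hs1 (v := ![1, 1])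
      (by intro i; fin_cases i <;> simp)
    have h2 := vertex_mem_of_ratio_le_one hKC hC hs hs1 (v := ![1, -1])
      (by intro i; fin_cases i <;> simp)
    have := huniq (LinearMap.proj 0)
      (fun h => by simpa using LinearMap.congr_fun h ![1, 1]) _ h1 _ h2
      (fun z hz => by simpa using (abs_le.1 (hKC hz 0)).2)
      (fun z hz => by simpa using (abs_le.1 (hKC hz 0)).2)
    have := congrFun this 1
    norm_num at this
  set M := (fun k => w - s • k) '' K with hMdef
  have hM : Convex ℝ M := hK.image_sub_smul w s
  have hMne : (interior M).Nonempty := ⟨0, mem_interior_of_abs_lt hC (by simp)⟩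
  have hmin : ∀ f : (Fin 2 → ℝ) →ₗ[ℝ] ℝ, ∀ k, (∀ z ∈ M, f z ≤ f (w - s • k)) →
      ∀ z ∈ K, (-f) z ≤ (-f) k := by
    intro f k hf z hz
    have := hf _ ⟨z, hz, rfl⟩
    simp only [map_sub, map_smul, smul_eq_mul] at this
    simp only [LinearMap.neg_apply, neg_le_neg_iff]
    exact le_of_mul_le_mul_left (by linarith) hs
  have hvert : ∀ y ∈ cube 2, y ∉ interior M → ∀ j, |y j| = 1 := by
    intro y hy hyM j
    by_contra hj
    have hlt : |y j| < 1 := lt_of_le_of_ne (hy j) hj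
    obtain ⟨f, hf0, hf⟩ := hM.exists_supporting hMne hyM
    have hδ : 0 < 1 - |y j| := by linarith
    have hb := abs_lt.1 hlt
    have hp : y + Pi.single j (1 - |y j|) ∈ cube 2 := add_single_mem_cube hy (by
      rw [abs_le]; constructor <;> linarith [neg_abs_le (y j), le_abs_self (y j)])
    have hm : y + Pi.single j (-(1 - |y j|)) ∈ cube 2 := add_single_mem_cube hy (by
      rw [abs_le]; constructor <;> linarith [neg_abs_le (y j), le_abs_self (y j)])
    obtain ⟨k, hk, hkp⟩ := hC hp
    obtain ⟨k', hk', hkm⟩ := hC hm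
    have hp1 := hf _ (hC hp)
    have hm1 := hf _ (hC hm)
    have hpe : f (w - s • k) = f y := by
      simp only at hkp
      rw [hkp]
      rw [map_add, Pi.single_neg, map_neg] at hm1
      rw [map_add] at hp1 ⊢
      linarith
    have hme : f (w - s • k') = f y := by
      simp only at hkm
      rw [hkm]
      rw [map_add, Pi.single_neg, map_neg] at hm1 ⊢
      rw [map_add] at hp1
      linarith
    have hkk := huniq (-f) (neg_ne_zero.2 hf0) k hk k' hk'
      (hmin f k (by rwa [hpe])) (hmin f k' (by rwa [hme]))
    rw [hkk, hkm] at hkp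
    have := congrFun hkp j
    simp at this
    linarith
  have hhalf : ∀ v ∈ cube 2, -v ∈ K → v ∉ interior M → v = w + s • v := by
    intro v hvC hv hvM
    obtain ⟨f, hf0, hf⟩ := hM.exists_supporting hMne hvM
    obtain ⟨k, hk, hkv⟩ := hC hvC
    simp only at hkv
    have : k = -v := huniq (-f) (neg_ne_zero.2 hf0) k hk (-v) hv
      (hmin f k (by rwa [hkv]))
      (fun z hz => by simpa using hf _ (hC (neg_mem_cube (hKC hz))))
    rw [this] at hkv
    nth_rewrite 1 [← hkv]
    simp
  have hopp : ∀ v ∈ K, -v ∈ K → v ∉ interior M → -v ∉ interior M → False := by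
    intro v hv hv' hvM hvM'
    have h1 := congrFun (hhalf v (hKC hv) hv' hvM) 0
    have h2 := congrFun (hhalf (-v) (hKC hv') (by simpa using hv) hvM') 0
    have h3 := hvert v (hKC hv) hvM 0
    simp at h1 h2
    have h4 : (s - 1) * v 0 = 0 := by linarith
    rcases mul_eq_zero.1 h4 with h | h
    · linarith
    · simp [h] at h3
  have hdir : ∃ (i : Fin 2) (τ : ℝ), ∀ y ∈ K, y ∉ interior M → y i = τ := by
    by_contra! hcon
    obtain ⟨a, ha, haM, -⟩ := hcon 0 0
    obtain ⟨b, hb, hbM, hab⟩ := hcon 0 (a 0)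
    obtain ⟨c, hc, hcM, hac⟩ := hcon 1 (a 1)
    have hne : ∀ x ∈ K, x ∉ interior M → ∀ y ∈ K, y ∉ interior M → y 0 = -x 0 → y 1 = -x 1 →
        False := by
      intro x hx hxM y hy hyM h0 h1
      have : y = -x := by
        ext l
        fin_cases l
        · exact h0
        · exact h1
      subst this
      exact hopp x hx hy hxM hyM
    have hsign : ∀ x ∈ K, x ∉ interior M → ∀ l, x l = 1 ∨ x l = -1 :=
      fun x hx hxM l => (abs_eq one_pos.le).1 (hvert x (hKC hx) hxM l)
    have hab' := hne a ha haM b hb hbM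
    have hac' := hne a ha haM c hc hcM
    have hbc' := hne b hb hbM c hc hcM
    have a0 := hsign a ha haM 0
    have a1 := hsign a ha haM 1
    have b0 := hsign b hb hbM 0
    have b1 := hsign b hb hbM 1
    have c0 := hsign c hc hcM 0
    have c1 := hsign c hc hcM 1
    clear hne hsign hvert hopp hhalf hmin huniq hno hopt hcon
    grind
  obtain ⟨i, τ, hτ⟩ := hdir
  obtain ⟨r, hr, hrs, c, hc⟩ := exists_lt_ratio hK hKc hs (hKC.trans hC) (Pi.single i (-τ)) (by
    intro y hy
    by_cases hyM : y ∈ interior M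
    · exact isOpen_interior.exists_pos_add_smul_mem hyM _
    · refine ⟨1, one_pos, ?_⟩
      have hyi := hτ y hy hyM
      by_contra hcon
      rw [one_smul] at hcon
      have := hvert _ (add_single_mem_cube (hKC hy) (by simp [hyi])) hcon i
      simp [hyi] at this)
  exact absurd (hopt r hr c hc) (not_le.2 hrs)

end Square

/-- Some parallelogram realizes the ratios admitted in the definition of `bmDist`. -/
lemma bmDist_set_nonempty {n : ℕ} {K : Set (Fin n → ℝ)} (hK : IsConvexBody K) :
    {r : ℝ | 0 < r ∧ ∃ (T : (Fin n → ℝ) ≃ₗ[ℝ] (Fin n → ℝ)) (u v : Fin n → ℝ),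
    (fun x => x + u) '' K ⊆ ⇑T '' ((fun x => x + v) '' cube n) ∧
    ⇑T '' ((fun x => x + v) '' cube n) ⊆ r • ((fun x => x + u) '' K)}.Nonempty := by
  obtain ⟨-, hKc, z, hz⟩ := hK
  obtain ⟨δ, hδ, hball⟩ := Metric.nhds_basis_closedBall.mem_iff.1 (mem_interior_iff_mem_nhds.1 hz)
  obtain ⟨R, hR, hKR⟩ := hKc.isBounded.subset_closedBall_lt 0 z
  refine ⟨R / δ, by positivity, LinearEquiv.smulOfNeZero ℝ _ R hR.ne', -z, 0, ?_, ?_⟩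
  · rintro _ ⟨k, hk, rfl⟩
    refine ⟨R⁻¹ • (k - z), ⟨R⁻¹ • (k - z), ?_, by simp⟩, ?_⟩
    · have := hKR hk
      rw [mem_closedBall_iff_norm] at this
      rw [cube_eq_closedBall, mem_closedBall_zero_iff, norm_smul, norm_inv, Real.norm_eq_abs,
        abs_of_pos hR, inv_mul_le_iff₀ hR]
      simpa using this
    · simp [smul_smul, hR.ne', sub_eq_add_neg]
  · rintro _ ⟨_, ⟨c, hc, rfl⟩, rfl⟩
    rw [cube_eq_closedBall, mem_closedBall_zero_iff] at hc
    refine ⟨δ • c, ⟨z + δ • c, hball ?_, by simp⟩, ?_⟩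
    · rw [mem_closedBall_iff_norm, add_sub_cancel_left, norm_smul, Real.norm_eq_abs, abs_of_pos hδ]
      nlinarith
    · simp [smul_smul, hδ.ne']

/-- The linear map with columns `a` and `b`. -/
def columnMap (a b : Fin 2 → ℝ) : (Fin 2 → ℝ) →ₗ[ℝ] (Fin 2 → ℝ) :=
  (LinearMap.proj 0).smulRight a + (LinearMap.proj 1).smulRight b

lemma columnMap_apply (a b c : Fin 2 → ℝ) : columnMap a b c = c 0 • a + c 1 • b := rfl

/-- The infimum defining `bmDist K (cube 2)` is attained. -/
lemma exists_optimal_parallelogram {K : Set (Fin 2 → ℝ)} (hK : IsConvexBody K) :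
    ∃ (T : (Fin 2 → ℝ) ≃ₗ[ℝ] (Fin 2 → ℝ)) (p w : Fin 2 → ℝ),
      (∀ k ∈ K, ∃ c ∈ cube 2, k = p + T c) ∧
      ∀ c ∈ cube 2, ∃ k ∈ K, p + T c = bmDist K (cube 2) • k + w := by
  obtain ⟨r, -, hr, hrS⟩ := exists_seq_tendsto_sInf (bmDist_set_nonempty hK) ⟨0, fun _ h => h.1.le⟩
  obtain ⟨-, hKc, hKne⟩ := hK
  change Filter.Tendsto r Filter.atTop (nhds (bmDist K (cube 2))) at hr
  have hdata : ∀ n, ∃ a b p w : Fin 2 → ℝ,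
      (∀ k ∈ K, ∃ c ∈ cube 2, k = p + columnMap a b c) ∧
      ∀ c ∈ cube 2, ∃ k ∈ K, p + columnMap a b c = r n • k + w := by
    intro n
    obtain ⟨-, T, u, v, h1, h2⟩ := hrS n
    have hT : ∀ c, columnMap (T (Pi.single 0 1)) (T (Pi.single 1 1)) c = T c := by
      intro c
      rw [columnMap_apply, ← map_smul, ← map_smul, ← map_add]
      congr 1
      ext l
      fin_cases l <;> simp
    refine ⟨T (Pi.single 0 1), T (Pi.single 1 1), T v - u, r n • u - u, fun k hk => ?_,
      fun c hc => ?_⟩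
    · obtain ⟨_, ⟨c, hc, rfl⟩, he⟩ := h1 ⟨k, hk, rfl⟩
      refine ⟨c, hc, ?_⟩
      simp only [map_add] at he
      rw [hT, ← add_sub_cancel_right k u, ← he]
      abel
    · obtain ⟨_, ⟨k, hk, rfl⟩, he⟩ := h2 ⟨_, ⟨c, hc, rfl⟩, rfl⟩
      refine ⟨k, hk, ?_⟩
      simp only [map_add, smul_add] at he
      rw [hT, ← add_sub_assoc, he]
      abel
  choose a b p w h1 h2 using hdata
  obtain ⟨R, hR, hKR⟩ := hKc.isBounded.exists_pos_norm_le
  obtain ⟨S, hS⟩ : ∃ S : ℝ, ∀ n, ‖r n‖ ≤ S := by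
    obtain ⟨S, hS⟩ := (Metric.isBounded_range_of_tendsto r hr).exists_norm_le
    exact ⟨S, fun n => hS _ ⟨n, rfl⟩⟩
  have hrk : ∀ n, ∀ k ∈ K, ‖r n • k‖ ≤ S * R := fun n k hk => by
    rw [norm_smul]
    exact mul_le_mul (hS n) (hKR k hk) (norm_nonneg _) ((norm_nonneg _).trans (hS n))
  have hw : ∀ n, ‖w n‖ ≤ R + S * R := by
    intro n
    obtain ⟨x, hx⟩ := hKne
    have hx := interior_subset hx
    obtain ⟨c, hc, he⟩ := h1 n x hx
    obtain ⟨k, hk, he'⟩ := h2 n c hc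
    have : w n = x - r n • k := by rw [he, he']; abel
    rw [this]
    exact (norm_sub_le _ _).trans (add_le_add (hKR x hx) (hrk n k hk))
  have hB : ∀ n, ∀ c ∈ cube 2, ‖p n + columnMap (a n) (b n) c‖ ≤ S * R + (R + S * R) := by
    intro n c hc
    obtain ⟨k, hk, he⟩ := h2 n c hc
    rw [he]
    exact (norm_add_le _ _).trans (add_le_add (hrk n k hk) (hw n))
  set B := S * R + (R + S * R)
  have hp : ∀ n, ‖p n‖ ≤ B := fun n => by simpa using hB n 0 (by simp [cube])
  have ha : ∀ n, ‖a n‖ ≤ B + B := fun n => by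
    have := hB n (Pi.single 0 1) (by intro i; fin_cases i <;> simp)
    rw [columnMap_apply] at this
    have h3 : a n = (p n + a n) - p n := by abel
    rw [h3]
    exact (norm_sub_le _ _).trans (add_le_add (by simpa using this) (hp n))
  have hb : ∀ n, ‖b n‖ ≤ B + B := fun n => by
    have := hB n (Pi.single 1 1) (by intro i; fin_cases i <;> simp)
    rw [columnMap_apply] at this
    have h3 : b n = (p n + b n) - p n := by abel
    rw [h3]
    exact (norm_sub_le _ _).trans (add_le_add (by simpa using this) (hp n))
  let U : Ultrafilter ℕ := Filter.hyperfilter ℕ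
  have hlim : ∀ {C : Set (Fin 2 → ℝ)}, IsCompact C → ∀ x : ℕ → Fin 2 → ℝ, (∀ n, x n ∈ C) →
      ∃ y ∈ C, Filter.Tendsto x U (nhds y) := by
    intro C hC x hx
    obtain ⟨y, hy, hle⟩ := hC.ultrafilter_le_nhds (U.map x)
      (by rw [Filter.le_principal_iff]; exact Filter.mem_map.2 (Filter.univ_mem' hx))
    exact ⟨y, hy, hle⟩
  have hlim' : ∀ (x : ℕ → Fin 2 → ℝ) (D : ℝ), (∀ n, ‖x n‖ ≤ D) →
      ∃ y, Filter.Tendsto x U (nhds y) := by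
    intro x D hx
    obtain ⟨y, -, hy⟩ := hlim (isCompact_closedBall 0 D) x (fun n => by simpa using hx n)
    exact ⟨y, hy⟩
  obtain ⟨a', ha'⟩ := hlim' a _ ha
  obtain ⟨b', hb'⟩ := hlim' b _ hb
  obtain ⟨p', hp'⟩ := hlim' p _ hp
  obtain ⟨w', hw'⟩ := hlim' w _ hw
  have hr' : Filter.Tendsto r U (nhds (bmDist K (cube 2))) :=
    hr.mono_left Nat.hyperfilter_le_atTop
  have hcube : IsCompact (cube 2) := cube_eq_closedBall 2 ▸ isCompact_closedBall 0 1
  have hcol : ∀ (c : ℕ → Fin 2 → ℝ) (c' : Fin 2 → ℝ), Filter.Tendsto c U (nhds c') →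
      Filter.Tendsto (fun n => p n + columnMap (a n) (b n) (c n)) U
        (nhds (p' + columnMap a' b' c')) := by
    intro c c' hc
    simp only [columnMap_apply]
    have hc0 := tendsto_pi_nhds.1 hc
    exact hp'.add (((hc0 0).smul ha').add ((hc0 1).smul hb'))
  have hin : ∀ k ∈ K, ∃ c ∈ cube 2, k = p' + columnMap a' b' c := by
    intro k hk
    choose c hc he using fun n => h1 n k hk
    obtain ⟨c', hc', hcc⟩ := hlim hcube c hc
    refine ⟨c', hc', tendsto_nhds_unique (tendsto_const_nhds (f := (U : Filter ℕ))) ?_⟩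
    exact (hcol c c' hcc).congr fun n => (he n).symm
  have hout : ∀ c ∈ cube 2, ∃ k ∈ K, p' + columnMap a' b' c = bmDist K (cube 2) • k + w' := by
    intro c hc
    choose k hk he using fun n => h2 n c hc
    obtain ⟨k', hk', hkk⟩ := hlim hKc k hk
    refine ⟨k', hk', tendsto_nhds_unique (hcol (fun _ => c) c tendsto_const_nhds) ?_⟩
    exact ((hr'.smul hkk).add hw').congr fun n => (he n).symm
  have hsurj : Function.Surjective (columnMap a' b') := by
    rw [← LinearMap.range_eq_top]
    apply Submodule.eq_top_of_nonempty_interior'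
    obtain ⟨x, hx⟩ := hKne
    refine ⟨x - p', ?_⟩
    rw [mem_interior]
    refine ⟨(fun y => y + p') ⁻¹' interior K, fun y hy => ?_,
      isOpen_interior.preimage (by fun_prop), by simpa using hx⟩
    obtain ⟨c, -, he⟩ := hin _ (interior_subset hy)
    exact ⟨c, add_left_cancel (he.symm.trans (add_comm y p'))⟩
  have hbij : Function.Bijective (columnMap a' b') :=
    ⟨LinearMap.injective_iff_surjective.2 hsurj, hsurj⟩
  exact ⟨LinearEquiv.ofBijective _ hbij, p', w', hin, hout⟩

/-- if a planar convex body `K` satisfies `d_BM(K, C₂) = as(K)`, then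
`K` is neither smooth nor strictly convex. -/
theorem stmt19 (K : Set (Fin 2 → ℝ)) (hK : IsConvexBody K)
    (h : bmDist K (cube 2) = asymConst K) :
    (∃ x ∈ frontier K, ∃ f g : (Fin 2 → ℝ) →ₗ[ℝ] ℝ,
      f ≠ 0 ∧ g ≠ 0 ∧ (¬ ∃ c : ℝ, g = c • f) ∧
      (∀ y ∈ K, f y ≤ f x) ∧ (∀ y ∈ K, g y ≤ g x)) ∧
    (∃ a b : Fin 2 → ℝ, a ≠ b ∧ a ∈ frontier K ∧ b ∈ frontier K ∧
      segment ℝ a b ⊆ frontier K) := by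
  obtain ⟨T, p, w, hin, hout⟩ := exists_optimal_parallelogram hK
  obtain ⟨hKconv, hKc, hKne⟩ := hK
  set s := bmDist K (cube 2) with hsdef
  have hs0 : 0 ≤ s := Real.sInf_nonneg fun _ hx => hx.1.le
  set L : Set (Fin 2 → ℝ) := (fun k => T.symm (k - p)) '' K with hLdef
  have hmem : ∀ c, c ∈ L ↔ p + T c ∈ K := by
    intro c
    constructor
    · rintro ⟨k, hk, rfl⟩
      simpa using hk
    · intro hc
      exact ⟨_, hc, by simp⟩
  have hLconv : Convex ℝ L := by
    intro x hx y hy α β hα hβ hαβ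
    rw [hmem] at hx hy ⊢
    have := hKconv hx hy hα hβ hαβ
    rw [smul_add, smul_add, add_add_add_comm, ← add_smul, hαβ, one_smul] at this
    simpa using this
  have hLc : IsCompact L := hKc.image
    ((LinearMap.continuous_of_finiteDimensional T.symm.toLinearMap).comp
      (continuous_id.sub continuous_const))
  have hLC : L ⊆ cube 2 := by
    rintro _ ⟨k, hk, rfl⟩
    obtain ⟨c, hc, rfl⟩ := hin k hk
    simpa using hc
  have hCL : cube 2 ⊆ (fun k => -T.symm ((s - 1) • p + w) - s • k) '' L := by
    intro c hc
    obtain ⟨k, hk, he⟩ := hout _ (neg_mem_cube hc)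
    refine ⟨_, ⟨k, hk, rfl⟩, ?_⟩
    have hTc : T c = -(s • k + w - p) := by
      rw [← he, map_neg]
      abel
    apply T.injective
    simp only [map_sub, map_neg, map_smul, LinearEquiv.apply_symm_apply]
    rw [hTc]
    module
  have hs : 0 < s := by
    refine lt_of_le_of_ne hs0 fun h0 => ?_
    obtain ⟨k, -, h1⟩ := hCL (show (1 : Fin 2 → ℝ) ∈ cube 2 from fun i => by simp)
    obtain ⟨k', -, h2⟩ := hCL (show (0 : Fin 2 → ℝ) ∈ cube 2 from fun i => by simp)
    simp only [← h0, zero_smul, sub_zero] at h1 h2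
    exact one_ne_zero (h1.symm.trans h2)
  have hopt : ∀ r : ℝ, 0 < r → ∀ c, (∀ k ∈ L, ∃ k' ∈ L, k = c - r • k') → s ≤ r := by
    intro r hr c hrc
    rw [h]
    refine asymConst_le hKconv hKne hr (p + r • p + T c) fun k hk => ?_
    obtain ⟨k', hk', he⟩ := hrc _ ⟨k, hk, rfl⟩
    refine ⟨p + T k', (hmem k').1 hk', ?_⟩
    have := congrArg T he
    simp only [map_sub, map_smul, LinearEquiv.apply_symm_apply] at this
    rw [sub_eq_iff_eq_add.1 this]
    module
  constructor
  · obtain ⟨v, hv, hv1⟩ := exists_vertex_mem hLconv hLc hLC hs hCL hopt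
    set F : Fin 2 → (Fin 2 → ℝ) →ₗ[ℝ] ℝ :=
      fun i => v i • (LinearMap.proj i ∘ₗ T.symm.toLinearMap) with hF
    have hFapp : ∀ i c, F i (T c) = v i * c i := by
      intro i c
      simp [hF]
    have hvv : ∀ i, v i * v i = 1 := fun i => by rw [← abs_mul_abs_self, hv1, one_mul]
    have hFne : ∀ i, F i ≠ 0 := by
      intro i h0
      have := hFapp i v
      rw [h0, hvv] at this
      simp at this
    have hFmax : ∀ i, ∀ y ∈ K, F i y ≤ F i (p + T v) := by
      intro i y hy
      obtain ⟨c, hc, rfl⟩ := hin y hy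
      rw [map_add, map_add, hFapp, hFapp, hvv]
      gcongr
      calc v i * c i ≤ |v i * c i| := le_abs_self _
        _ = |c i| := by rw [abs_mul, hv1, one_mul]
        _ ≤ 1 := hc i
    have hvK := (hmem v).1 hv
    refine ⟨p + T v, mem_frontier_of_isMax (hFne 0) hvK (hFmax 0), F 0, F 1, hFne 0, hFne 1, ?_,
      hFmax 0, hFmax 1⟩
    rintro ⟨c, hc⟩
    have h1 := LinearMap.congr_fun hc (T (Pi.single 1 (v 1)))
    rw [LinearMap.smul_apply c, hFapp, hFapp] at h1
    simp [hvv] at h1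
  · obtain ⟨f, hf, a, ha, b, hb, hab, hfa, hfb⟩ :=
      exists_two_maximizers hLconv hLc hLC hs hCL hopt
    set g : (Fin 2 → ℝ) →ₗ[ℝ] ℝ := f ∘ₗ T.symm.toLinearMap with hg
    have hgapp : ∀ c, g (T c) = f c := fun c => by simp [hg]
    have hgne : g ≠ 0 := by
      refine fun h0 => hf (LinearMap.ext fun c => ?_)
      rw [← hgapp, h0]
      simp
    have hmax : ∀ c ∈ L, (∀ z ∈ L, f z ≤ f c) → ∀ y ∈ K, g y ≤ g (p + T c) := by
      intro c hc hfc y hy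
      have hy' := hfc _ ⟨y, hy, rfl⟩
      have : y = p + T (T.symm (y - p)) := by simp
      rw [this, map_add, map_add, hgapp, hgapp]
      gcongr
    have hga := hmax a ha hfa
    have hgb := hmax b hb hfb
    have haK := (hmem a).1 ha
    have hbK := (hmem b).1 hb
    refine ⟨p + T a, p + T b, fun he => hab (T.injective (add_left_cancel he)),
      mem_frontier_of_isMax hgne haK hga, mem_frontier_of_isMax hgne hbK hgb, ?_⟩
    intro x hx
    have hxK := hKconv.segment_subset haK hbK hx
    refine mem_frontier_of_isMax hgne hxK fun z hz => ?_
    obtain ⟨α, β, hα, hβ, hαβ, rfl⟩ := hx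
    have h1 := hga z hz
    have h2 := hgb z hz
    rw [map_add g (α • _), map_smul, map_smul, smul_eq_mul, smul_eq_mul]
    calc g z = α * g z + β * g z := by rw [← add_mul, hαβ, one_mul]
      _ ≤ _ := by gcongr
end
end
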